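/- arXiv:2312.10174 — 2 statements merged into one kernel-verified Lean document; each statement's English description precedes it below -/
import Mathlib

section
/- Let α > 0, σ ∈ ℝ, and g_σ(x) = e^{−(α+iσ)x²}. Let Λ ⊂ ℝ be a separated set. Then the following are equivalent: (1) the Gabor system G(g_σ, Λ × ℤ) is a frame in L²(ℝ); (2) for every x ∈ ℝ, the translate Λ + x is a sampling set for V²(g_σ); (3) D⁻(Λ) > 1. -/
open MeasureTheory Filter Metric Complex

noncomputable section

/-- A set `Λ ⊆ ℝ` is separated. -/
def Separated (Λ : Set ℝ) : Prop :=
  ∃ δ : ℝ, 0 < δ ∧ ∀ x ∈ Λ, ∀ y ∈ Λ, x ≠ y → δ ≤ |x - y|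

/-- Lower Beurling density. -/
def lowerDensity (Λ : Set ℝ) : ℝ :=
  liminf (fun r : ℝ => ⨅ x : ℝ, ((Λ ∩ Set.Icc x (x + r)).ncard : ℝ) / r) atTop

def upperDensity (Λ : Set ℝ) : ℝ :=
  limsup (fun r : ℝ => ⨆ x : ℝ, ((Λ ∩ Set.Icc x (x + r)).ncard : ℝ) / r) atTop

/-- Gabor coefficient. -/
def gaborCoef (g f : ℝ → ℂ) (p : ℝ × ℝ) : ℂ :=
  ∫ t : ℝ, f t * (starRingEnd ℂ) (Complex.exp (-2 * Real.pi * Complex.I * p.2 * t) * g (p.1 - t))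

def IsGaborFrame (g : ℝ → ℂ) (S : Set (ℝ × ℝ)) : Prop :=
  ∃ A B : ℝ, 0 < A ∧ 0 < B ∧ ∀ f : ℝ → ℂ, MemLp f 2 (volume : Measure ℝ) →
    A * (∫ t : ℝ, ‖f t‖ ^ 2) ≤ (∑' p : S, ‖gaborCoef g f p‖ ^ 2) ∧
    (∑' p : S, ‖gaborCoef g f p‖ ^ 2) ≤ B * (∫ t : ℝ, ‖f t‖ ^ 2)

/-- membership in shift invariant space -/
def InV2 (g : ℝ → ℂ) (f : ℝ → ℂ) : Prop :=
  ∃ c : ℤ → ℂ, Memℓp c 2 ∧ ∀ x : ℝ, HasSum (fun n : ℤ => c n * g (x - n)) (f x)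

def IsSamplingSet (g : ℝ → ℂ) (Λ : Set ℝ) : Prop :=
  ∃ A B : ℝ, 0 < A ∧ 0 < B ∧ ∀ f : ℝ → ℂ, InV2 g f →
    A * (∫ t : ℝ, ‖f t‖ ^ 2) ≤ (∑' l : Λ, ‖f l‖ ^ 2) ∧
    (∑' l : Λ, ‖f l‖ ^ 2) ≤ B * (∫ t : ℝ, ‖f t‖ ^ 2)

def IsInterpolatingSet (g : ℝ → ℂ) (Λ : Set ℝ) : Prop :=
  ∀ a : Λ → ℂ, Memℓp a 2 → ∃ f : ℝ → ℂ, InV2 g f ∧ ∀ l : Λ, f l = a l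

def IsSamplingSeqV (g : ℝ → ℂ) (lam : ℤ → ℝ) : Prop :=
  ∃ A B : ℝ, 0 < A ∧ 0 < B ∧ ∀ f : ℝ → ℂ, InV2 g f →
    A * (∫ t : ℝ, ‖f t‖ ^ 2) ≤ (∑' m : ℤ, ‖f (lam m)‖ ^ 2) ∧
    (∑' m : ℤ, ‖f (lam m)‖ ^ 2) ≤ B * (∫ t : ℝ, ‖f t‖ ^ 2)

/-- Fock weight function φ. -/
def phiF (β γ : ℝ) (z : ℂ) : ℝ :=
  β * (Real.log (‖z‖)) ^ 2 + γ * Real.log (‖z‖)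

def MemFock (β γ : ℝ) (F : ℂ → ℂ) : Prop :=
  DifferentiableOn ℂ F {(0 : ℂ)}ᶜ ∧
    Integrable (fun z : ℂ => ‖F z‖ ^ 2 * Real.exp (-2 * phiF β γ z)) volume

def fockNormSq (β γ : ℝ) (F : ℂ → ℂ) : ℝ :=
  (1 / Real.pi) * ∫ z : ℂ, ‖F z‖ ^ 2 * Real.exp (-2 * phiF β γ z)

def fockWeight (β γ : ℝ) (w : ℂ) : ℝ :=
  (1 + ‖w‖ ^ 2) * Real.exp (-2 * phiF β γ w)

def IsFockSamplingSeq (β γ : ℝ) (u : ℤ → ℂ) : Prop :=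
  ∃ A B : ℝ, 0 < A ∧ 0 < B ∧ ∀ F : ℂ → ℂ, MemFock β γ F →
    A * fockNormSq β γ F ≤ (∑' m : ℤ, fockWeight β γ (u m) * ‖F (u m)‖ ^ 2) ∧
    (∑' m : ℤ, fockWeight β γ (u m) * ‖F (u m)‖ ^ 2) ≤ B * fockNormSq β γ F

def IsFockInterpolatingSeq (β γ : ℝ) (u : ℤ → ℂ) : Prop :=
  ∀ a : ℤ → ℂ, Summable (fun m : ℤ => fockWeight β γ (u m) * ‖a m‖ ^ 2) →
    ∃ F : ℂ → ℂ, MemFock β γ F ∧ ∀ m : ℤ, F (u m) = a m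

def IsFockSamplingSet (β γ : ℝ) (Λ : Set ℂ) : Prop :=
  ∃ A B : ℝ, 0 < A ∧ 0 < B ∧ ∀ F : ℂ → ℂ, MemFock β γ F →
    A * fockNormSq β γ F ≤ (∑' w : Λ, fockWeight β γ w * ‖F w‖ ^ 2) ∧
    (∑' w : Λ, fockWeight β γ w * ‖F w‖ ^ 2) ≤ B * fockNormSq β γ F

def IsFockInterpolatingSet (β γ : ℝ) (Λ : Set ℂ) : Prop :=
  ∀ a : Λ → ℂ, Summable (fun w : Λ => fockWeight β γ (w : ℂ) * ‖a w‖ ^ 2) →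
    ∃ F : ℂ → ℂ, MemFock β γ F ∧ ∀ w : Λ, F w = a w

/-- the canonical product A(z) -/
def Afun (a b : ℂ) (z : ℂ) : ℂ :=
  ∏' n : ℕ, (1 + z * Complex.exp (-(a + b) * (n + 1)))

def Gfun (a b : ℂ) (z : ℂ) : ℂ := (1 + z) * Afun a b z * Afun a b (1 / z)

/-- the discrete Cauchy transform G(z) Σ c_n e^{an}/(z+e^{(a+b)n}) -/
def cauchyT (a b : ℂ) (c : ℤ → ℂ) (z : ℂ) : ℂ :=
  Gfun a b z * ∑' n : ℤ, c n * Complex.exp (a * n) / (z + Complex.exp ((a + b) * n))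

/-- norm of the evaluation functional at `w` on `H_{a,b}` -/
def Hnorm (a b : ℂ) (w : ℂ) : ℝ :=
  sSup {r : ℝ | ∃ c : ℤ → ℂ, Memℓp c 2 ∧ (∑' n : ℤ, ‖c n‖ ^ 2) ≤ 1 ∧ r = ‖cauchyT a b c w‖}

def IsSamplingSeqH (a b : ℂ) (u : ℤ → ℂ) : Prop :=
  ∃ A B : ℝ, 0 < A ∧ 0 < B ∧ ∀ c : ℤ → ℂ, Memℓp c 2 →
    A * (∑' n : ℤ, ‖c n‖ ^ 2) ≤ (∑' m : ℤ, ((Hnorm a b (u m)) ^ 2)⁻¹ * ‖cauchyT a b c (u m)‖ ^ 2) ∧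
    (∑' m : ℤ, ((Hnorm a b (u m)) ^ 2)⁻¹ * ‖cauchyT a b c (u m)‖ ^ 2) ≤ B * (∑' n : ℤ, ‖c n‖ ^ 2)

open scoped ENNReal NNReal

/-- A family of reals whose members are pairwise at distance at least `δ`. -/
def SepFamily {ι : Type} (δ : ℝ) (γ : ι → ℝ) : Prop :=
  ∀ i j, i ≠ j → δ ≤ |γ i - γ j|

/-- The exponential weight `e^{-|t|}` as an extended nonnegative real. -/
def expDecay (t : ℝ) : ℝ≥0∞ := ENNReal.ofReal (Real.exp (-|t|))

/-- A uniform bound for sums of `expDecay` along `δ`-separated families. -/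
def sepConst (δ : ℝ) : ℝ≥0∞ :=
  ENNReal.ofReal (Real.exp δ) * ∑' m : ℤ, ENNReal.ofReal (Real.exp (-(δ * |(m : ℝ)|)))

lemma summable_exp_neg_mul_abs_int {δ : ℝ} (hδ : 0 < δ) :
    Summable fun m : ℤ => Real.exp (-(δ * |(m : ℝ)|)) := by
  have h : Summable fun n : ℕ => Real.exp (-(δ * (n : ℝ))) := by
    have h1 : Summable fun n : ℕ => (Real.exp (-δ)) ^ n :=
      summable_geometric_of_lt_one (Real.exp_pos _).le (by simpa using hδ)
    refine h1.congr fun n => ?_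
    rw [← Real.exp_nat_mul]; ring_nf
  refine Summable.of_nat_of_neg ?_ ?_ <;> simpa using h

lemma sepConst_ne_top {δ : ℝ} (hδ : 0 < δ) : sepConst δ ≠ ∞ := by
  refine ENNReal.mul_ne_top ENNReal.ofReal_ne_top ?_
  rw [← ENNReal.ofReal_tsum_of_nonneg (fun _ => (Real.exp_pos _).le)
    (summable_exp_neg_mul_abs_int hδ)]
  exact ENNReal.ofReal_ne_top

lemma tsum_expDecay_le {ι : Type} {δ : ℝ} (hδ : 0 < δ) {γ : ι → ℝ} (hγ : SepFamily δ γ) (y : ℝ) :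
    ∑' i, expDecay (γ i - y) ≤ sepConst δ := by
  have hinj : Function.Injective fun i => ⌊(γ i - y) / δ⌋ := by
    intro i j hij
    by_contra hne
    have h1 := Int.abs_sub_lt_one_of_floor_eq_floor hij
    have h2 : (γ i - y) / δ - (γ j - y) / δ = (γ i - γ j) / δ := by ring
    rw [h2, abs_div, abs_of_pos hδ, div_lt_one hδ] at h1
    exact absurd (hγ i j hne) (not_le.mpr h1)
  refine le_trans ?_ (mul_le_mul_right (ENNReal.tsum_comp_le_tsum_of_injective hinj
    (fun m : ℤ => ENNReal.ofReal (Real.exp (-(δ * |(m : ℝ)|))))) _)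
  rw [← ENNReal.tsum_mul_left]
  refine ENNReal.tsum_le_tsum fun i => ?_
  rw [← ENNReal.ofReal_mul (Real.exp_pos _).le, ← Real.exp_add]
  refine ENNReal.ofReal_le_ofReal (Real.exp_le_exp.mpr ?_)
  set t := (γ i - y) / δ with ht
  have h3 : γ i - y = δ * t := by rw [ht]; field_simp
  rw [h3, abs_mul, abs_of_pos hδ]
  have h4 : |(⌊t⌋ : ℝ)| ≤ |t| + 1 := by
    have a := Int.floor_le t
    have b := Int.lt_floor_add_one t
    rw [abs_le]
    constructor
    · linarith [neg_abs_le t]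
    · linarith [le_abs_self t]
  nlinarith

lemma sepFamily_int : SepFamily 1 (fun n : ℤ => (n : ℝ)) := by
  intro i j hij
  have : (1 : ℤ) ≤ |i - j| := Int.one_le_abs (sub_ne_zero.mpr hij)
  have h2 : (1 : ℝ) ≤ |(i : ℝ) - j| := by exact_mod_cast this
  exact h2

lemma expDecay_sub_comm (s t : ℝ) : expDecay (s - t) = expDecay (t - s) := by
  simp [expDecay, abs_sub_comm]

lemma tsum_expDecay_int_le (y : ℝ) : ∑' n : ℤ, expDecay (y - n) ≤ sepConst 1 := by
  simp_rw [expDecay_sub_comm y]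
  exact tsum_expDecay_le one_pos sepFamily_int y

lemma sq_tsum_mul_le {κ : Type} (k b : κ → ℝ≥0∞) :
    (∑' n, k n * b n) ^ 2 ≤ (∑' n, k n) * ∑' n, k n * b n ^ 2 := by
  let _ : MeasurableSpace κ := ⊤
  have key := ENNReal.lintegral_mul_le_Lp_mul_Lq (Measure.count : Measure κ)
    Real.HolderConjugate.two_two (f := fun n => k n ^ (1 / 2 : ℝ))
    (g := fun n => k n ^ (1 / 2 : ℝ) * b n) (measurable_from_top.aemeasurable)
    (measurable_from_top.aemeasurable)
  rw [lintegral_count, lintegral_count, lintegral_count] at key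
  have hk : ∀ x : ℝ≥0∞, x ^ (1 / 2 : ℝ) * x ^ (1 / 2 : ℝ) = x := fun x => by
    rw [← ENNReal.rpow_add_of_nonneg _ _ (by norm_num) (by norm_num)]; norm_num
  have hk2 : ∀ x : ℝ≥0∞, (x ^ (1 / 2 : ℝ)) ^ 2 = x := fun x => by rw [sq, hk]
  simp only [Pi.mul_apply, ← mul_assoc, hk, ENNReal.rpow_two, mul_pow, hk2] at key
  calc _ ≤ _ := pow_le_pow_left' key 2
    _ = _ := by rw [mul_pow, hk2, hk2]

/-- Schur's test for the kernel `e^{-|γ_i - n|}`. -/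
lemma expDecay_schur {ι : Type} {δ : ℝ} (hδ : 0 < δ) {γ : ι → ℝ} (hγ : SepFamily δ γ)
    (b : ℤ → ℝ≥0∞) :
    ∑' i, (∑' n : ℤ, expDecay (γ i - n) * b n) ^ 2 ≤
      sepConst 1 * sepConst δ * ∑' n, b n ^ 2 := by
  calc _ ≤ ∑' i, sepConst 1 * ∑' n : ℤ, expDecay (γ i - n) * b n ^ 2 :=
        ENNReal.tsum_le_tsum fun i => (sq_tsum_mul_le _ _).trans
          (mul_le_mul_left (tsum_expDecay_int_le _) _)
    _ = sepConst 1 * ∑' n : ℤ, (∑' i, expDecay (γ i - n)) * b n ^ 2 := by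
        rw [ENNReal.tsum_mul_left, ENNReal.tsum_comm]
        simp_rw [ENNReal.tsum_mul_right]
    _ ≤ sepConst 1 * ∑' n : ℤ, sepConst δ * b n ^ 2 := by
        gcongr with n
        exact tsum_expDecay_le hδ hγ n
    _ = _ := by rw [ENNReal.tsum_mul_left, mul_assoc]

/-- The chirped Gaussian `e^{-a x²}`. -/
def chirp (a : ℂ) (x : ℝ) : ℂ := Complex.exp (-a * (x : ℂ) ^ 2)

/-- The synthesis operator `c ↦ ∑ cₙ chirp (· - n)`. -/
def synth (a : ℂ) (c : ℤ → ℂ) (x : ℝ) : ℂ := ∑' n : ℤ, c n * chirp a (x - n)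

lemma norm_chirp (a : ℂ) (x : ℝ) : ‖chirp a x‖ = Real.exp (-(a.re * x ^ 2)) := by
  rw [chirp, Complex.norm_exp]
  congr 1
  rw [← Complex.ofReal_pow, Complex.re_mul_ofReal]
  simp

lemma gaussian_le_exp {α : ℝ} (hα : 0 < α) (k t : ℝ) :
    Real.exp (-(α * t ^ 2)) ≤ Real.exp (k ^ 2 / (4 * α)) * Real.exp (-(k * |t|)) := by
  rw [← Real.exp_add]
  refine Real.exp_le_exp.mpr ?_
  have h : k ^ 2 / (4 * α) + -(k * |t|) - -(α * t ^ 2) = α * (|t| - k / (2 * α)) ^ 2 := by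
    rw [← sq_abs t]; field_simp; ring
  nlinarith [mul_nonneg hα.le (sq_nonneg (|t| - k / (2 * α)))]

lemma norm_chirp_le {a : ℂ} (ha : 0 < a.re) (k t : ℝ) :
    ‖chirp a t‖ ≤ Real.exp (k ^ 2 / (4 * a.re)) * Real.exp (-(k * |t|)) := by
  rw [norm_chirp]; exact gaussian_le_exp ha k t

lemma hasDerivAt_chirp (a : ℂ) (t : ℝ) :
    HasDerivAt (chirp a) (-2 * a * t * chirp a t) t := by
  have h : HasDerivAt (fun z : ℂ => Complex.exp (-a * z ^ 2))
      (Complex.exp (-a * (t : ℂ) ^ 2) * (-a * (2 * t))) (t : ℂ) := by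
    have := (((hasDerivAt_pow 2 (t : ℂ)).const_mul (-a))).cexp
    simpa using this
  refine h.comp_ofReal.congr_deriv ?_
  rw [chirp]; ring

/-- The Lipschitz constant in `norm_chirp_sub_le`. -/
def chirpLip (a : ℂ) : ℝ := 2 * ‖a‖ * Real.exp (9 / (4 * a.re) + 2)

lemma norm_chirp_sub_le {a : ℂ} (ha : 0 < a.re) {s t : ℝ} (hst : |s - t| ≤ 1) :
    ‖chirp a s - chirp a t‖ ≤ chirpLip a * |s - t| * Real.exp (-(2 * |t|)) := by
  have hb : ∀ u ∈ Set.uIcc t s, ‖-2 * a * u * chirp a u‖ ≤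
      chirpLip a * Real.exp (-(2 * |t|)) := by
    intro u hu
    have hu1 : |u - t| ≤ 1 := (Set.abs_sub_left_of_mem_uIcc hu).trans hst
    have h1 : |t| ≤ |u| + 1 := by
      have := abs_sub_abs_le_abs_sub t u
      rw [abs_sub_comm] at this; linarith
    have h2 : |u| ≤ Real.exp |u| := by linarith [Real.add_one_le_exp |u|]
    have h3 := norm_chirp_le ha 3 u
    rw [norm_mul, norm_mul, norm_mul, Complex.norm_real, Real.norm_eq_abs]
    calc ‖(-2 : ℂ)‖ * ‖a‖ * |u| * ‖chirp a u‖
        ≤ ‖(-2 : ℂ)‖ * ‖a‖ * Real.exp |u| *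
          (Real.exp (3 ^ 2 / (4 * a.re)) * Real.exp (-(3 * |u|))) := by gcongr
      _ = 2 * ‖a‖ * Real.exp (9 / (4 * a.re) + -(2 * |u|)) := by
          rw [mul_assoc (‖(-2 : ℂ)‖ * ‖a‖), ← Real.exp_add, ← Real.exp_add]
          congr 2
          · simp
          · ring
      _ ≤ 2 * ‖a‖ * Real.exp (9 / (4 * a.re) + 2 + -(2 * |t|)) := by
          refine mul_le_mul_of_nonneg_left (Real.exp_le_exp.mpr ?_) (by positivity)
          linarith
      _ = _ := by rw [Real.exp_add _ (-(2 * |t|)), chirpLip, ← mul_assoc]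
  have := (convex_uIcc t s).norm_image_sub_le_of_norm_hasDerivWithin_le
    (fun u _ => (hasDerivAt_chirp a u).hasDerivWithinAt) hb Set.left_mem_uIcc Set.right_mem_uIcc
  rw [Real.norm_eq_abs] at this
  linarith

lemma chirpLip_nonneg (a : ℂ) : 0 ≤ chirpLip a := by unfold chirpLip; positivity

lemma enorm_le_ofReal {z : ℂ} {r : ℝ} (h : ‖z‖ ≤ r) : ‖z‖ₑ ≤ ENNReal.ofReal r := by
  rw [← ofReal_norm]; exact ENNReal.ofReal_le_ofReal h

lemma enorm_chirp_le {a : ℂ} (ha : 0 < a.re) (t : ℝ) :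
    ‖chirp a t‖ₑ ≤ ENNReal.ofReal (Real.exp (1 / (4 * a.re))) * expDecay t := by
  rw [expDecay, ← ENNReal.ofReal_mul (Real.exp_pos _).le]
  refine enorm_le_ofReal ?_
  simpa using norm_chirp_le ha 1 t

/-- `∑ |cₙ|²` in the extended nonnegative reals. -/
def sqSum {κ : Type} (c : κ → ℂ) : ℝ≥0∞ := ∑' n, ‖c n‖ₑ ^ 2

/-- A sequence dominated by an exponentially decaying kernel satisfies a Bessel bound. -/
lemma tsum_enorm_sq_le_of_kernel {ι : Type} {δ : ℝ} (hδ : 0 < δ) {γ : ι → ℝ}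
    (hγ : SepFamily δ γ) {u : ι → ℂ} {b : ℤ → ℝ≥0∞} {η : ℝ≥0∞}
    (h : ∀ i, ‖u i‖ₑ ≤ ∑' n : ℤ, η * expDecay (γ i - n) * b n) :
    sqSum u ≤ η ^ 2 * (sepConst 1 * sepConst δ) * ∑' n, b n ^ 2 := by
  calc sqSum u ≤ ∑' i, (η * ∑' n : ℤ, expDecay (γ i - n) * b n) ^ 2 := by
        refine ENNReal.tsum_le_tsum fun i => pow_le_pow_left' ((h i).trans ?_) 2
        simp_rw [mul_assoc, ENNReal.tsum_mul_left]; rfl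
    _ = η ^ 2 * ∑' i, (∑' n : ℤ, expDecay (γ i - n) * b n) ^ 2 := by
        simp_rw [mul_pow, ENNReal.tsum_mul_left]
    _ ≤ η ^ 2 * (sepConst 1 * sepConst δ * ∑' n, b n ^ 2) := by
        gcongr; exact expDecay_schur hδ hγ b
    _ = _ := by ring

/-- The upper sampling constant for `δ`-separated families. -/
def besselConst (a : ℂ) (δ : ℝ) : ℝ≥0∞ :=
  ENNReal.ofReal (Real.exp (1 / (4 * a.re))) ^ 2 * (sepConst 1 * sepConst δ)

lemma besselConst_ne_top (a : ℂ) {δ : ℝ} (hδ : 0 < δ) : besselConst a δ ≠ ∞ :=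
  ENNReal.mul_ne_top (ENNReal.pow_ne_top ENNReal.ofReal_ne_top)
    (ENNReal.mul_ne_top (sepConst_ne_top one_pos) (sepConst_ne_top hδ))

lemma sqSum_synth_le {a : ℂ} (ha : 0 < a.re) {ι : Type} {δ : ℝ} (hδ : 0 < δ) {γ : ι → ℝ}
    (hγ : SepFamily δ γ) (c : ℤ → ℂ) :
    sqSum (fun i => synth a c (γ i)) ≤ besselConst a δ * sqSum c := by
  refine tsum_enorm_sq_le_of_kernel hδ hγ (b := fun n => ‖c n‖ₑ) fun i => ?_
  refine enorm_tsum_le_tsum_enorm.trans (ENNReal.tsum_le_tsum fun n => ?_)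
  rw [enorm_mul, mul_comm]
  gcongr
  exact enorm_chirp_le ha _

lemma norm_le_of_sqSum {c : ℤ → ℂ} (hc : sqSum c ≠ ∞) :
    ∃ M : ℝ, ∀ n, ‖c n‖ ≤ M := by
  refine ⟨(sqSum c + 1).toReal, fun n => ?_⟩
  have h1 : ‖c n‖ₑ ^ 2 ≤ sqSum c := ENNReal.le_tsum (f := fun n => ‖c n‖ₑ ^ 2) n
  have h2 : ‖c n‖ₑ ≤ sqSum c + 1 := by
    rcases le_total ‖c n‖ₑ 1 with h | h
    · exact h.trans le_add_self
    · refine le_trans ?_ (h1.trans le_self_add)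
      rw [sq]; exact le_mul_of_one_le_left' h
  rw [← toReal_enorm]
  exact ENNReal.toReal_mono (by simp [hc]) h2

lemma summable_exp_neg_abs_sub (x : ℝ) : Summable fun n : ℤ => Real.exp (-|x - n|) := by
  have h := (tsum_expDecay_int_le x).trans_lt (sepConst_ne_top one_pos).lt_top
  have := ENNReal.summable_toReal h.ne
  refine this.congr fun n => ?_
  rw [expDecay, ENNReal.toReal_ofReal (Real.exp_pos _).le]

lemma summable_synth {a : ℂ} (ha : 0 < a.re) {c : ℤ → ℂ} (hc : sqSum c ≠ ∞) (x : ℝ) :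
    Summable fun n : ℤ => c n * chirp a (x - n) := by
  obtain ⟨M, hM⟩ := norm_le_of_sqSum hc
  refine Summable.of_norm_bounded
    (g := fun n : ℤ => M * (Real.exp (1 / (4 * a.re)) * Real.exp (-|x - n|)))
    (((summable_exp_neg_abs_sub x).mul_left _).mul_left _) fun n => ?_
  rw [norm_mul]
  refine mul_le_mul (hM n) ?_ (norm_nonneg _) ((norm_nonneg _).trans (hM n))
  simpa using norm_chirp_le ha 1 (x - n)

lemma synth_add_int (a : ℂ) (c : ℤ → ℂ) (x : ℝ) (k : ℤ) :
    synth a c (x + k) = synth a (fun n => c (n + k)) x := by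
  unfold synth
  rw [← (Equiv.addRight k).tsum_eq]
  refine tsum_congr fun n => ?_
  simp

lemma sqSum_shift (c : ℤ → ℂ) (k : ℤ) : sqSum (fun n => c (n + k)) = sqSum c :=
  (Equiv.addRight k).tsum_eq fun n => ‖c n‖ₑ ^ 2

lemma SepFamily.add_const {ι : Type} {δ : ℝ} {γ : ι → ℝ} (h : SepFamily δ γ) (x : ℝ) :
    SepFamily δ fun i => γ i + x := fun i j hij => by simpa using h i j hij

lemma exists_eq_prod_mul {U : Set ℂ} (hU : IsOpen U) {ι : Type} (s : Finset ι) (w : ι → ℂ)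
    (hw : Set.InjOn w s) (hwU : ∀ i ∈ s, w i ∈ U) {E : ℂ → ℂ} (hE : DifferentiableOn ℂ E U)
    (h0 : ∀ i ∈ s, E (w i) = 0) :
    ∃ H : ℂ → ℂ, DifferentiableOn ℂ H U ∧ ∀ z, E z = (∏ i ∈ s, (z - w i)) * H z := by
  classical
  induction s using Finset.induction_on generalizing E with
  | empty => exact ⟨E, hE, by simp⟩
  | insert i s his ih =>
    have hi : ∀ z, E z = (z - w i) * dslope E (w i) z := fun z => by
      have := sub_smul_dslope E (w i) z
      rw [h0 i (by simp), sub_zero, smul_eq_mul] at this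
      exact this.symm
    have hd : DifferentiableOn ℂ (dslope E (w i)) U :=
      (differentiableOn_dslope (hU.mem_nhds (hwU i (by simp)))).mpr hE
    obtain ⟨H, hH, hEH⟩ := ih (hw.mono (by simp)) (fun j hj => hwU j (by simp [hj])) hd (by
      intro j hj
      have h1 := hi (w j)
      rw [h0 j (by simp [hj])] at h1
      refine (mul_eq_zero.mp h1.symm).resolve_left fun h2 => his ?_
      have := hw (by simp [hj]) (by simp) (sub_eq_zero.mp h2)
      exact this ▸ hj)
    refine ⟨H, hH, fun z => ?_⟩
    rw [hi, hEH, Finset.prod_insert his, mul_assoc]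

lemma norm_le_of_norm_le_on_circles {S D : ℝ} (hS : 0 ≤ S) {H : ℂ → ℂ}
    (hH : DifferentiableOn ℂ H {0}ᶜ)
    (h1 : ∀ z : ℂ, ‖z‖ = Real.exp S → ‖H z‖ ≤ D)
    (h2 : ∀ z : ℂ, ‖z‖ = Real.exp (-S) → ‖H z‖ ≤ D) {z : ℂ} (hz : ‖z‖ = 1) : ‖H z‖ ≤ D := by
  rcases hS.eq_or_lt with rfl | hS
  · exact h1 z (by simpa using hz)
  set U : Set ℂ := norm ⁻¹' Set.Ioo (Real.exp (-S)) (Real.exp S) with hU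
  have hUo : IsOpen U := isOpen_Ioo.preimage continuous_norm
  have hcl : closure U ⊆ norm ⁻¹' Set.Icc (Real.exp (-S)) (Real.exp S) :=
    closure_minimal (Set.preimage_mono Set.Ioo_subset_Icc_self)
      (isClosed_Icc.preimage continuous_norm)
  have hsub : closure U ⊆ {0}ᶜ := fun x hx hx0 => by
    have := (hcl hx).1
    rw [Set.mem_singleton_iff.mp hx0, norm_zero] at this
    exact absurd this (not_le.mpr (Real.exp_pos _))
  refine norm_le_of_forall_mem_frontier_norm_le (U := U) ?_
    ((hH.mono hsub).diffContOnCl) ?_ (subset_closure ?_)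
  · refine (isBounded_closedBall (x := (0 : ℂ)) (r := Real.exp S)).subset fun x hx => ?_
    simpa using hx.2.le
  · intro x hx
    have hx1 := hcl hx.1
    have hx2 : x ∉ U := by simpa [hUo.interior_eq] using hx.2
    rcases hx1.1.eq_or_lt with h | h
    · exact h2 x h.symm
    rcases hx1.2.eq_or_lt with h' | h'
    · exact h1 x h'
    · exact absurd ⟨h, h'⟩ hx2
  · change ‖z‖ ∈ Set.Ioo (Real.exp (-S)) (Real.exp S)
    rw [hz]
    exact ⟨by simpa using hS, by simpa using hS⟩

/-- A function on the punctured plane with many zeros on both sides of the unit circle is small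
there compared with its size on the circles of radii `e^{±S}`. -/
lemma norm_le_of_zeros {ι : Type} [Fintype ι] {S B X : ℝ} (hS : 1 ≤ S) {w v : ι → ℂ}
    (hinj : Function.Injective (Sum.elim w v))
    (hw1 : ∀ i, 1 ≤ ‖w i‖) (hw2 : ∀ i, ‖w i‖ ≤ Real.exp (S - 1))
    (hv1 : ∀ i, ‖v i‖ ≤ 1) (hv2 : ∀ i, Real.exp (-(S - 1)) ≤ ‖v i‖)
    (hX : ∏ i, ‖w i‖ ≤ X) (hX' : ∏ i, ‖v i‖⁻¹ ≤ X)
    {E : ℂ → ℂ} (hE : DifferentiableOn ℂ E {0}ᶜ) (hEw : ∀ i, E (w i) = 0) (hEv : ∀ i, E (v i) = 0)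
    (h1 : ∀ z : ℂ, ‖z‖ = Real.exp S → ‖E z‖ ≤ B)
    (h2 : ∀ z : ℂ, ‖z‖ = Real.exp (-S) → ‖E z‖ ≤ B) {z : ℂ} (hz : ‖z‖ = 1) :
    ‖E z‖ ≤ 16 ^ Fintype.card ι * Real.exp (-(S * Fintype.card ι)) * X * B := by
  set k := Fintype.card ι with hk
  have hv0 : ∀ i, 0 < ‖v i‖ := fun i => (Real.exp_pos _).trans_le (hv2 i)
  have hw0 : ∀ i, 0 < ‖w i‖ := fun i => one_pos.trans_le (hw1 i)
  obtain ⟨H, hH, hEH⟩ := exists_eq_prod_mul (U := {0}ᶜ) isOpen_compl_singleton Finset.univ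
    (Sum.elim w v) hinj.injOn (by
      rintro (i | i) -
      · simpa using norm_pos_iff.mp (hw0 i)
      · simpa using norm_pos_iff.mp (hv0 i)) hE (by
      rintro (i | i) -
      · exact hEw i
      · exact hEv i)
  have hEn : ∀ z, ‖E z‖ = (∏ i, ‖z - w i‖) * (∏ i, ‖z - v i‖) * ‖H z‖ := fun z => by
    rw [hEH, Fintype.prod_sum_type]; simp [norm_prod]
  have hB : 0 ≤ B := (norm_nonneg _).trans (h1 (Real.exp S) (by simp))
  have hPw : 0 < ∏ i, ‖w i‖ := Finset.prod_pos fun i _ => hw0 i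
  have hPv : 0 < ∏ i, ‖v i‖ := Finset.prod_pos fun i _ => hv0 i
  have hX0 : 0 ≤ X := hPw.le.trans hX
  have he : Real.exp (-(S * k)) = Real.exp (-S) ^ k := by
    rw [← Real.exp_nat_mul]; ring_nf
  have he' : Real.exp S * Real.exp (-S) = 1 := by rw [← Real.exp_add]; simp
  have hhalf : Real.exp (-1) ≤ 1 / 2 := by
    have := Real.add_one_le_exp (1 : ℝ)
    rw [Real.exp_neg, one_div]
    exact inv_anti₀ two_pos (by linarith)
  have hconst : ∀ r : ℝ, r ^ k = ∏ _i : ι, r := fun r => by simp [hk]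
  set D := 4 ^ k * Real.exp (-S) ^ k * X * B / ∏ i, ‖w i‖ with hD
  have hmax : ‖z ^ k * H z‖ ≤ D := by
    refine norm_le_of_norm_le_on_circles (by linarith : 0 ≤ S) (H := fun z => z ^ k * H z)
      ((differentiable_pow k).differentiableOn.mul hH) ?_ ?_ hz
    · intro z hz
      have ha : (Real.exp S / 2) ^ k ≤ ∏ i, ‖z - w i‖ := by
        rw [hconst]
        refine Finset.prod_le_prod (fun _ _ => by positivity) fun i _ => ?_
        have := norm_sub_norm_le z (w i)
        have h3 := hw2 i
        rw [sub_eq_add_neg, Real.exp_add] at h3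
        nlinarith [Real.exp_pos S]
      have hb : (Real.exp S / 2) ^ k ≤ ∏ i, ‖z - v i‖ := by
        rw [hconst]
        refine Finset.prod_le_prod (fun _ _ => by positivity) fun i _ => ?_
        have := norm_sub_norm_le z (v i)
        have h3 := hv1 i
        have h4 := Real.add_one_le_exp S
        rw [hz] at this
        linarith
      have h3 := h1 z hz
      rw [hEn] at h3
      have h4 : (Real.exp S / 2) ^ k * (Real.exp S / 2) ^ k * ‖H z‖ ≤ B :=
        le_trans (by gcongr) h3
      rw [norm_mul, norm_pow, hz, hD, le_div_iff₀ hPw]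
      calc Real.exp S ^ k * ‖H z‖ * ∏ i, ‖w i‖
          = 4 ^ k * Real.exp (-S) ^ k * (∏ i, ‖w i‖) *
              ((Real.exp S / 2) ^ k * (Real.exp S / 2) ^ k * ‖H z‖) := by
            have : (4 : ℝ) ^ k * Real.exp (-S) ^ k * ((Real.exp S / 2) ^ k * (Real.exp S / 2) ^ k)
                = Real.exp S ^ k := by
              rw [← mul_pow, ← mul_pow, ← mul_pow]
              congr 1
              linear_combination Real.exp S * he'
            rw [← this]; ring
        _ ≤ 4 ^ k * Real.exp (-S) ^ k * X * B := by gcongr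
    · intro z hz
      have ha : (∏ i, ‖w i‖) * (1 / 2) ^ k ≤ ∏ i, ‖z - w i‖ := by
        rw [hconst, ← Finset.prod_mul_distrib]
        refine Finset.prod_le_prod (fun _ _ => by positivity) fun i _ => ?_
        have := norm_sub_norm_le (w i) z
        have h3 := hw1 i
        have h5 : Real.exp (-S) ≤ Real.exp (-1) := Real.exp_le_exp.mpr (by linarith)
        rw [norm_sub_rev, hz] at this
        linarith
      have hb : (∏ i, ‖v i‖) * (1 / 2) ^ k ≤ ∏ i, ‖z - v i‖ := by
        rw [hconst, ← Finset.prod_mul_distrib]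
        refine Finset.prod_le_prod (fun _ _ => by positivity) fun i _ => ?_
        have := norm_sub_norm_le (v i) z
        have h3 := hv2 i
        have h5 : Real.exp (-S) = Real.exp (-(S - 1)) * Real.exp (-1) := by
          rw [← Real.exp_add]; ring_nf
        rw [norm_sub_rev, hz] at this
        nlinarith [Real.exp_pos (-(S - 1)), Real.exp_pos (-1)]
      have h3 := h2 z hz
      rw [hEn] at h3
      have h4 : (∏ i, ‖w i‖) * (1 / 2) ^ k * ((∏ i, ‖v i‖) * (1 / 2) ^ k) * ‖H z‖ ≤ B :=
        le_trans (by gcongr) h3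
      rw [Finset.prod_inv_distrib] at hX'
      rw [norm_mul, norm_pow, hz, hD, le_div_iff₀ hPw]
      calc Real.exp (-S) ^ k * ‖H z‖ * ∏ i, ‖w i‖
          = 4 ^ k * Real.exp (-S) ^ k * (∏ i, ‖v i‖)⁻¹ *
              ((∏ i, ‖w i‖) * (1 / 2) ^ k * ((∏ i, ‖v i‖) * (1 / 2) ^ k) * ‖H z‖) := by
            have h6 : (4 : ℝ) ^ k * ((1 / 2) ^ k * (1 / 2) ^ k) = 1 := by
              rw [← mul_pow, ← mul_pow]; norm_num
            have h7 : (∏ i, ‖v i‖)⁻¹ * (∏ i, ‖v i‖) = 1 := inv_mul_cancel₀ hPv.ne'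
            linear_combination (-(Real.exp (-S) ^ k * ‖H z‖ * ∏ i, ‖w i‖)) * h6 -
              (Real.exp (-S) ^ k * ‖H z‖ * (∏ i, ‖w i‖) *
                ((4 : ℝ) ^ k * ((1 / 2) ^ k * (1 / 2) ^ k))) * h7
        _ ≤ 4 ^ k * Real.exp (-S) ^ k * X * B := by gcongr
  rw [norm_mul, norm_pow, hz, one_pow, one_mul] at hmax
  have ha : ∏ i, ‖z - w i‖ ≤ 2 ^ k * ∏ i, ‖w i‖ := by
    rw [hconst, ← Finset.prod_mul_distrib]
    refine Finset.prod_le_prod (fun _ _ => norm_nonneg _) fun i _ => ?_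
    have := norm_sub_le z (w i)
    linarith [hw1 i]
  have hb : ∏ i, ‖z - v i‖ ≤ 2 ^ k := by
    rw [hconst]
    refine Finset.prod_le_prod (fun _ _ => norm_nonneg _) fun i _ => ?_
    have := norm_sub_le z (v i)
    linarith [hv1 i]
  rw [hEn, he]
  calc _ ≤ 2 ^ k * (∏ i, ‖w i‖) * 2 ^ k * D := by
        have : 0 ≤ D := (norm_nonneg _).trans hmax
        gcongr
    _ = 2 ^ k * 2 ^ k * 4 ^ k * (Real.exp (-S) ^ k * X * B) := by
        rw [hD]; field_simp
    _ = _ := by rw [← mul_pow, ← mul_pow]; norm_num; ring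

lemma exists_interpolant {ι : Type} [Fintype ι] {ρ κ ε : ℝ} (hκ : 0 < κ) {w : ι → ℂ}
    (hw : ∀ i, ‖w i‖ ≤ ρ) (hsep : ∀ i j, i ≠ j → κ ≤ ‖w i - w j‖) {y : ι → ℂ}
    (hy : ∀ i, ‖y i‖ ≤ ε) :
    ∃ Q : Polynomial ℂ, (∀ i, Q.eval (w i) = y i) ∧ ∀ z : ℂ, ‖z‖ ≤ ρ →
      ‖Q.eval z‖ ≤ Fintype.card ι * (max 1 (2 * ρ / κ)) ^ Fintype.card ι * ε := by
  classical
  have hinj : Function.Injective w := fun i j hij => by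
    by_contra hne
    have := hsep i j hne
    rw [hij, sub_self, norm_zero] at this
    exact absurd hκ (not_lt.mpr this)
  refine ⟨Lagrange.interpolate Finset.univ w y,
    fun i => Lagrange.eval_interpolate_at_node y hinj.injOn (Finset.mem_univ i), fun z hz => ?_⟩
  rw [Lagrange.interpolate_apply, Polynomial.eval_finsetSum]
  refine (norm_sum_le_of_le _ (f := _) (n := fun _ => (max 1 (2 * ρ / κ)) ^ Fintype.card ι * ε)
    fun i _ => ?_).trans (by simp [mul_assoc])
  rw [Polynomial.eval_mul, Polynomial.eval_C, norm_mul, mul_comm]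
  refine mul_le_mul ?_ (hy i) (norm_nonneg _) (by positivity)
  rw [Lagrange.basis, Polynomial.eval_prod, norm_prod]
  calc _ ≤ ∏ _j ∈ Finset.univ.erase i, max 1 (2 * ρ / κ) := by
        refine Finset.prod_le_prod (fun _ _ => norm_nonneg _) fun j hj => ?_
        rw [Lagrange.basisDivisor]
        simp only [Polynomial.eval_mul, Polynomial.eval_C, Polynomial.eval_sub, Polynomial.eval_X,
          norm_mul, norm_inv]
        refine le_trans ?_ (le_max_right _ _)
        rw [mul_comm, ← div_eq_mul_inv]
        have h1 := hsep i j (Finset.ne_of_mem_erase hj).symm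
        have h2 : ‖z - w j‖ ≤ 2 * ρ := (norm_sub_le _ _).trans (by linarith [hw j])
        exact div_le_div₀ ((norm_nonneg _).trans h2) h2 hκ h1
    _ ≤ _ := by
        rw [Finset.prod_const]
        exact pow_le_pow_right₀ (le_max_left _ _) (Finset.card_le_univ _)

/-- Quantitative form of `norm_le_of_zeros`: small values instead of zeros. -/
lemma exists_norm_le_of_small_values (ι : Type) [Fintype ι] {S κ X : ℝ} (hS : 1 ≤ S)
    (hκ : 0 < κ) (hX₀ : 0 ≤ X) :
    ∃ K : ℝ, 0 ≤ K ∧ ∀ w v : ι → ℂ,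
      (∀ i j, i ≠ j → κ ≤ ‖Sum.elim w v i - Sum.elim w v j‖) →
      (∀ i, 1 ≤ ‖w i‖) → (∀ i, ‖w i‖ ≤ Real.exp (S - 1)) →
      (∀ i, ‖v i‖ ≤ 1) → (∀ i, Real.exp (-(S - 1)) ≤ ‖v i‖) →
      (∏ i, ‖w i‖ ≤ X) → (∏ i, ‖v i‖⁻¹ ≤ X) →
      ∀ (F : ℂ → ℂ) (B ε : ℝ), DifferentiableOn ℂ F {0}ᶜ →
      (∀ i, ‖F (w i)‖ ≤ ε) → (∀ i, ‖F (v i)‖ ≤ ε) →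
      (∀ z : ℂ, ‖z‖ = Real.exp S → ‖F z‖ ≤ B) → (∀ z : ℂ, ‖z‖ = Real.exp (-S) → ‖F z‖ ≤ B) →
      ∀ z : ℂ, ‖z‖ = 1 →
        ‖F z‖ ≤ 16 ^ Fintype.card ι * Real.exp (-(S * Fintype.card ι)) * X * B + K * ε := by
  set T := 16 ^ Fintype.card ι * Real.exp (-(S * Fintype.card ι)) * X with hT
  have hT0 : 0 ≤ T := by positivity
  set L : ℝ := Fintype.card (ι ⊕ ι) * (max 1 (2 * Real.exp S / κ)) ^ Fintype.card (ι ⊕ ι) with hL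
  have hL0 : 0 ≤ L := by positivity
  refine ⟨T * L + L, by positivity, ?_⟩
  intro w v hsep hw1 hw2 hv1 hv2 hX hX' F B ε hF hFw hFv h1 h2 z hz
  have hS1 : Real.exp (S - 1) ≤ Real.exp S := Real.exp_le_exp.mpr (by linarith)
  have hS2 : 1 ≤ Real.exp S := Real.one_le_exp (by linarith)
  have hS3 : Real.exp (-S) ≤ Real.exp S := Real.exp_le_exp.mpr (by linarith)
  obtain ⟨Q, hQ, hQb⟩ := exists_interpolant (w := Sum.elim w v) (ρ := Real.exp S) (ε := ε)
    (y := fun i => F (Sum.elim w v i)) hκ (by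
      rintro (i | i)
      · exact (hw2 i).trans hS1
      · exact (hv1 i).trans hS2) hsep (by
      rintro (i | i)
      · exact hFw i
      · exact hFv i)
  have hinj : Function.Injective (Sum.elim w v) := fun i j hij => by
    by_contra hne
    have := hsep i j hne
    rw [hij, sub_self, norm_zero] at this
    exact absurd hκ (not_lt.mpr this)
  have key := norm_le_of_zeros (B := B + L * ε) hS hinj hw1 hw2 hv1 hv2 hX hX'
    (E := fun z => F z - Q.eval z) (hF.sub Q.differentiable.differentiableOn)
    (fun i => sub_eq_zero.mpr (hQ (Sum.inl i)).symm)
    (fun i => sub_eq_zero.mpr (hQ (Sum.inr i)).symm)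
    (fun z hz => (norm_sub_le _ _).trans (add_le_add (h1 z hz) (hQb z hz.le)))
    (fun z hz => (norm_sub_le _ _).trans (add_le_add (h2 z hz) (hQb z (hz.le.trans hS3)))) hz
  have h5 := hQb z (hz.le.trans hS2)
  have h6 : ‖F z‖ ≤ ‖F z - Q.eval z‖ + ‖Q.eval z‖ := by
    simpa using norm_add_le (F z - Q.eval z) (Q.eval z)
  rw [← hT] at key
  rw [← hL] at h5
  linarith

/-- The Laurent series attached to `synth a c` by the change of variable `z = e^{2ax}`. -/
def laurent (a : ℂ) (c : ℤ → ℂ) (z : ℂ) : ℂ :=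
  ∑' n : ℤ, c n * Complex.exp (-a * (n : ℂ) ^ 2) * z ^ n

lemma norm_laurent_term_le {a : ℂ} (ha : 0 < a.re) (c : ℂ) (n : ℤ) {S : ℝ} {z : ℂ}
    (h1 : Real.exp (-S) ≤ ‖z‖) (h2 : ‖z‖ ≤ Real.exp S) :
    ‖c * Complex.exp (-a * (n : ℂ) ^ 2) * z ^ n‖ ≤
      Real.exp ((S + 1) ^ 2 / (4 * a.re)) * (Real.exp (-|(n : ℝ)|) * ‖c‖) := by
  have hz : 0 < ‖z‖ := (Real.exp_pos _).trans_le h1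
  have hg : ‖Complex.exp (-a * (n : ℂ) ^ 2)‖ ≤
      Real.exp ((S + 1) ^ 2 / (4 * a.re)) * Real.exp (-((S + 1) * |(n : ℝ)|)) := by
    have := norm_chirp_le ha (S + 1) n
    rwa [chirp, Complex.ofReal_intCast] at this
  have hn : ‖z‖ ^ n ≤ Real.exp (S * |(n : ℝ)|) := by
    rw [← Real.rpow_intCast, Real.rpow_def_of_pos hz]
    refine Real.exp_le_exp.mpr ?_
    have h3 : |Real.log ‖z‖| ≤ S := by
      rw [abs_le]
      exact ⟨(Real.le_log_iff_exp_le hz).mpr h1, (Real.log_le_iff_le_exp hz).mpr h2⟩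
    calc _ ≤ |Real.log ‖z‖ * n| := le_abs_self _
      _ ≤ _ := by rw [abs_mul]; gcongr
  rw [norm_mul, norm_mul, norm_zpow]
  calc _ ≤ ‖c‖ * (Real.exp ((S + 1) ^ 2 / (4 * a.re)) * Real.exp (-((S + 1) * |(n : ℝ)|))) *
        Real.exp (S * |(n : ℝ)|) := by gcongr
    _ = ‖c‖ * Real.exp ((S + 1) ^ 2 / (4 * a.re)) *
        (Real.exp (-((S + 1) * |(n : ℝ)|)) * Real.exp (S * |(n : ℝ)|)) := by ring
    _ = ‖c‖ * Real.exp ((S + 1) ^ 2 / (4 * a.re)) * Real.exp (-|(n : ℝ)|) := by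
        rw [← Real.exp_add]; ring_nf
    _ = _ := by ring

lemma norm_laurent_le {a : ℂ} (ha : 0 < a.re) {c : ℤ → ℂ}
    (hc : Summable fun n : ℤ => Real.exp (-|(n : ℝ)|) * ‖c n‖) {S : ℝ} {z : ℂ}
    (h1 : Real.exp (-S) ≤ ‖z‖) (h2 : ‖z‖ ≤ Real.exp S) :
    ‖laurent a c z‖ ≤
      Real.exp ((S + 1) ^ 2 / (4 * a.re)) * ∑' n : ℤ, Real.exp (-|(n : ℝ)|) * ‖c n‖ := by
  rw [← tsum_mul_left]
  exact tsum_of_norm_bounded (hc.mul_left _).hasSum fun n => norm_laurent_term_le ha _ n h1 h2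

lemma differentiableOn_laurent {a : ℂ} (ha : 0 < a.re) {c : ℤ → ℂ}
    (hc : Summable fun n : ℤ => Real.exp (-|(n : ℝ)|) * ‖c n‖) :
    DifferentiableOn ℂ (laurent a c) {0}ᶜ := by
  intro z hz
  have hz0 : 0 < ‖z‖ := norm_pos_iff.mpr hz
  set S := |Real.log ‖z‖| + 1 with hS
  set U : Set ℂ := norm ⁻¹' Set.Ioo (Real.exp (-S)) (Real.exp S) with hU
  have hUo : IsOpen U := isOpen_Ioo.preimage continuous_norm
  have hzU : z ∈ U := by
    refine ⟨?_, ?_⟩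
    · rw [← Real.lt_log_iff_exp_lt hz0]; linarith [neg_abs_le (Real.log ‖z‖)]
    · rw [← Real.log_lt_iff_lt_exp hz0]; linarith [le_abs_self (Real.log ‖z‖)]
  have := differentiableOn_tsum_of_summable_norm
    (F := fun (n : ℤ) (z : ℂ) => c n * Complex.exp (-a * (n : ℂ) ^ 2) * z ^ n)
    (hc.mul_left (Real.exp ((S + 1) ^ 2 / (4 * a.re)))) (U := U) ?_ hUo
    (fun n w hw => norm_laurent_term_le ha _ n hw.1.le hw.2.le)
  · exact ((this z hzU).differentiableAt (hUo.mem_nhds hzU)).differentiableWithinAt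
  · intro n w hw
    have hw0 : w ≠ 0 := norm_pos_iff.mp ((Real.exp_pos _).trans hw.1)
    exact ((differentiableAt_zpow.mpr (Or.inl hw0)).const_mul _).differentiableWithinAt

lemma synth_eq_laurent (a : ℂ) (c : ℤ → ℂ) (x : ℝ) :
    synth a c x = Complex.exp (-a * (x : ℂ) ^ 2) * laurent a c (Complex.exp (2 * a * x)) := by
  rw [synth, laurent, ← tsum_mul_left]
  refine tsum_congr fun n => ?_
  rw [← Complex.exp_int_mul, chirp, mul_assoc, ← Complex.exp_add, mul_left_comm, ← Complex.exp_add]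
  congr 2
  push_cast
  ring

lemma norm_coeff_zero_le {a : ℂ} (ha : 0 < a.re) {c : ℤ → ℂ}
    (hc : Summable fun n : ℤ => Real.exp (-|(n : ℝ)|) * ‖c n‖) {D : ℝ}
    (hD : ∀ z : ℂ, ‖z‖ = 1 → ‖laurent a c z‖ ≤ D) : ‖c 0‖ ≤ D := by
  set f : ℤ → C(ℝ, ℂ) := fun n => ⟨fun θ => c n * Complex.exp (-a * (n : ℂ) ^ 2) *
    Complex.exp ((n * I) * θ), by fun_prop⟩ with hf
  have hz : ∀ θ : ℝ, ‖Complex.exp (θ * I)‖ = 1 := Complex.norm_exp_ofReal_mul_I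
  have hterm : ∀ n (θ : ℝ), f n θ =
      c n * Complex.exp (-a * (n : ℂ) ^ 2) * Complex.exp (θ * I) ^ n := fun n θ => by
    simp only [hf, ContinuousMap.coe_mk]
    rw [← Complex.exp_int_mul]; ring_nf
  have hbound : ∀ n (θ : ℝ), ‖f n θ‖ ≤
      Real.exp ((0 + 1) ^ 2 / (4 * a.re)) * (Real.exp (-|(n : ℝ)|) * ‖c n‖) := fun n θ => by
    rw [hterm]
    exact norm_laurent_term_le ha _ n (by simp [hz]) (by simp [hz])
  have hsum := intervalIntegral.hasSum_intervalIntegral_of_summable_norm (a := 0)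
    (b := 2 * Real.pi) (f := f) (Summable.of_nonneg_of_le (fun _ => norm_nonneg _)
      (fun n => (ContinuousMap.norm_le _ (by positivity)).mpr fun θ => hbound n θ)
      (hc.mul_left (Real.exp ((0 + 1) ^ 2 / (4 * a.re)))))
  have h0 : ∀ n : ℤ, n ≠ 0 → ∫ θ in (0 : ℝ)..(2 * Real.pi), f n θ = 0 := by
    intro n hn
    simp only [hf, ContinuousMap.coe_mk]
    rw [intervalIntegral.integral_const_mul, integral_exp_mul_complex (by simp [hn])]
    have : Complex.exp (n * I * ((2 * Real.pi : ℝ) : ℂ)) = 1 := by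
      rw [Complex.exp_eq_one_iff]; exact ⟨n, by push_cast; ring⟩
    rw [this]; simp
  have h1 := hsum.unique (hasSum_single 0 h0)
  have h2 : ∫ θ in (0 : ℝ)..(2 * Real.pi), f 0 θ = 2 * Real.pi * c 0 := by
    simp [hf]
  have h3 : ‖∫ θ in (0 : ℝ)..(2 * Real.pi), ∑' n, f n θ‖ ≤ D * |2 * Real.pi - 0| := by
    refine intervalIntegral.norm_integral_le_of_norm_le_const fun θ _ => ?_
    simp_rw [hterm]
    exact hD _ (hz θ)
  rw [h1, h2, norm_mul, sub_zero, abs_of_pos Real.two_pi_pos] at h3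
  have h4 : ‖(2 * Real.pi : ℂ)‖ = 2 * Real.pi := by
    rw [norm_mul, Complex.norm_real, Real.norm_of_nonneg Real.pi_pos.le]; simp
  rw [h4, mul_comm D] at h3
  exact le_of_mul_le_mul_left h3 Real.two_pi_pos

/-- Every half-open interval of length `r` contains at least `q` members of the family. -/
def BlockDense {ι : Type} (r : ℝ) (q : ℕ) (γ : ι → ℝ) : Prop :=
  ∀ x, ∃ e : Fin q → ι, Function.Injective e ∧ ∀ i, γ (e i) ∈ Set.Ico x (x + r)

lemma BlockDense.add_const {ι : Type} {r : ℝ} {q : ℕ} {γ : ι → ℝ} (h : BlockDense r q γ) (y : ℝ) :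
    BlockDense r q fun i => γ i + y := fun x => by
  obtain ⟨e, he, hm⟩ := h (x - y)
  exact ⟨e, he, fun i => ⟨by linarith [(hm i).1], by linarith [(hm i).2]⟩⟩

lemma norm_exp_two_mul (a : ℂ) (x : ℝ) : ‖Complex.exp (2 * a * x)‖ = Real.exp (2 * a.re * x) := by
  rw [Complex.norm_exp, Complex.re_mul_ofReal]; simp

lemma exp_sub_exp_ge {α δ s x y : ℝ} (hα : 0 < α) (hδ : 0 < δ) (hx : -s ≤ 2 * α * x)
    (hy : -s ≤ 2 * α * y) (hxy : δ ≤ |x - y|) :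
    Real.exp (-s) * (2 * α * δ) ≤ |Real.exp (2 * α * x) - Real.exp (2 * α * y)| := by
  wlog hle : y ≤ x generalizing x y
  · rw [abs_sub_comm]
    exact this hy hx (by rwa [abs_sub_comm]) (le_of_not_ge hle)
  rw [abs_of_nonneg (by linarith)] at hxy
  have h1 : Real.exp (2 * α * x) = Real.exp (2 * α * y) * Real.exp (2 * α * (x - y)) := by
    rw [← Real.exp_add]; ring_nf
  have h2 := Real.add_one_le_exp (2 * α * (x - y))
  have h3 := Real.exp_le_exp.mpr hy
  have h4 : 2 * α * δ ≤ 2 * α * (x - y) := by gcongr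
  refine le_trans ?_ (le_abs_self _)
  calc _ ≤ Real.exp (2 * α * y) * (Real.exp (2 * α * (x - y)) - 1) := by
        gcongr; linarith
    _ = _ := by rw [h1]; ring

lemma exists_small_gain {α r θ : ℝ} {q : ℕ} (hα : 0 < α) (hr : 0 < r) (hq : r < q) (hθ : 0 < θ) :
    ∃ m : ℕ, 16 ^ (m * q) * Real.exp (-((2 * α * r * m + 1) * (m * q : ℕ))) *
      Real.exp (α * q * r * (m * (m + 1))) *
        Real.exp ((2 * α * r * m + 1 + 1) ^ 2 / (4 * α)) ≤ θ := by
  set b : ℝ := q * Real.log 16 - q + α * q * r + 2 * r with hb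
  have key : ∀ m : ℕ, 16 ^ (m * q) * Real.exp (-((2 * α * r * m + 1) * (m * q : ℕ))) *
      Real.exp (α * q * r * (m * (m + 1))) * Real.exp ((2 * α * r * m + 1 + 1) ^ 2 / (4 * α)) =
      Real.exp (m * (-(α * r * (q - r)) * m + b) + 1 / α) := by
    intro m
    have h16 : (16 : ℝ) ^ (m * q) = Real.exp (m * q * Real.log 16) := by
      rw [← Real.rpow_natCast, Real.rpow_def_of_pos (by norm_num)]; push_cast; ring_nf
    rw [h16, ← Real.exp_add, ← Real.exp_add, ← Real.exp_add]
    congr 1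
    rw [hb]; push_cast; field_simp; ring
  simp_rw [key]
  have hneg : -(α * r * (q - r)) < 0 := by
    have : 0 < α * r * (q - r) := mul_pos (mul_pos hα hr) (by linarith)
    linarith
  have hlin : Tendsto (fun m : ℕ => -(α * r * (q - r)) * (m : ℝ) + b) atTop atBot :=
    tendsto_atBot_add_const_right _ _
      (tendsto_natCast_atTop_atTop.const_mul_atTop_of_neg hneg)
  have hall : Tendsto (fun m : ℕ => Real.exp ((m : ℝ) * (-(α * r * (q - r)) * m + b) + 1 / α))
      atTop (nhds 0) :=
    Real.tendsto_exp_atBot.comp (tendsto_atBot_add_const_right _ _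
      (tendsto_natCast_atTop_atTop.atTop_mul_atBot₀ hlin))
  exact (hall.eventually_le_const hθ).exists

/-- The zeroth coefficient is controlled by finitely many samples up to a small error. -/
lemma exists_coeff_bound {a : ℂ} (ha : 0 < a.re) {δ r θ : ℝ} {q : ℕ} (hδ : 0 < δ) (hr : 0 < r)
    (hq : r < q) (hθ : 0 < θ) :
    ∃ K R : ℝ, 0 ≤ K ∧ ∀ (ι : Type) (γ : ι → ℝ), SepFamily δ γ → BlockDense r q γ →
      ∀ c : ℤ → ℂ, (Summable fun n : ℤ => Real.exp (-|(n : ℝ)|) * ‖c n‖) →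
      ∀ ε : ℝ, 0 ≤ ε → (∀ i, |γ i| ≤ R → ‖synth a c (γ i)‖ ≤ ε) →
        ‖c 0‖ ≤ θ * ∑' n : ℤ, Real.exp (-|(n : ℝ)|) * ‖c n‖ + K * ε := by
  obtain ⟨m, hm⟩ := exists_small_gain ha hr hq hθ
  set α := a.re with hαdef
  set S := 2 * α * r * m + 1 with hS
  have hS1 : 1 ≤ S := by
    have : 0 ≤ 2 * α * r * m := by positivity
    linarith
  set X := Real.exp (α * q * r * (m * (m + 1))) with hX
  obtain ⟨K, hK, hmain⟩ := exists_norm_le_of_small_values (Fin m × Fin q) (X := X) hS1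
    (mul_pos (Real.exp_pos (-S)) (by positivity : 0 < 2 * α * δ)) (Real.exp_pos _).le
  refine ⟨K * Real.exp (α * (r * m) ^ 2), r * m, by positivity, ?_⟩
  intro ι γ hγ hdense c hc ε hε hsmall
  choose e hinj hmem using hdense
  set p : (Fin m × Fin q) → ι := fun x => e (x.1 * r) x.2 with hp
  set n : (Fin m × Fin q) → ι := fun x => e (-(x.1 + 1) * r) x.2 with hn
  have hcast : ∀ i : Fin m, (i : ℝ) + 1 ≤ m := fun i => by exact_mod_cast i.2
  have hp1 : ∀ x, (x.1 : ℝ) * r ≤ γ (p x) := fun x => (hmem _ _).1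
  have hp2 : ∀ x, γ (p x) < (x.1 + 1 : ℝ) * r := fun x => by
    have := (hmem (x.1 * r) x.2).2; linarith
  have hn1 : ∀ x, -(x.1 + 1 : ℝ) * r ≤ γ (n x) := fun x => (hmem _ _).1
  have hn2 : ∀ x, γ (n x) < -(x.1 : ℝ) * r := fun x => by
    have := (hmem (-(x.1 + 1) * r) x.2).2; linarith
  have hup : ∀ i : Fin m, ((i : ℝ) + 1) * r ≤ r * m := fun i => by
    rw [mul_comm]; exact mul_le_mul_of_nonneg_left (hcast i) hr.le
  have hlo : ∀ i : Fin m, 0 ≤ (i : ℝ) * r := fun i => by positivity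
  have hpn : Function.Injective (Sum.elim p n) := by
    have hfp : ∀ x, ⌊γ (p x) / r⌋ = (x.1 : ℤ) := fun x => by
      rw [Int.floor_eq_iff]
      constructor
      · rw [le_div_iff₀ hr]; simpa using hp1 x
      · rw [div_lt_iff₀ hr]; simpa using hp2 x
    have hfn : ∀ x, ⌊γ (n x) / r⌋ = -(x.1 : ℤ) - 1 := fun x => by
      rw [Int.floor_eq_iff]
      constructor
      · rw [le_div_iff₀ hr]; have := hn1 x; push_cast; linarith
      · rw [div_lt_iff₀ hr]; have := hn2 x; push_cast; linarith
    rintro (x | x) (y | y) hxy <;> simp only [Sum.elim_inl, Sum.elim_inr] at hxy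
    · have h1 := hfp x
      rw [hxy, hfp y] at h1
      have h2 : x.1 = y.1 := by ext; exact_mod_cast h1.symm
      simp only [hp, h2] at hxy
      rw [Prod.ext h2 (hinj _ hxy)]
    · have h1 := hfp x
      rw [hxy, hfn y] at h1
      omega
    · have h1 := hfn x
      rw [hxy, hfp y] at h1
      omega
    · have h1 := hfn x
      rw [hxy, hfn y] at h1
      have h2 : x.1 = y.1 := by ext; omega
      simp only [hn, h2] at hxy
      rw [Prod.ext h2 (hinj _ hxy)]
  have habs : ∀ x, |γ (Sum.elim p n x)| ≤ r * m := by
    rintro (x | x) <;> simp only [Sum.elim_inl, Sum.elim_inr] <;> rw [abs_le]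
    · constructor <;> linarith [hp1 x, hp2 x, hup x.1, hlo x.1]
    · constructor <;> linarith [hn1 x, hn2 x, hup x.1, hlo x.1]
  set ex : ι → ℂ := fun i => Complex.exp (2 * a * γ i) with hex
  have hexn : ∀ i, ‖ex i‖ = Real.exp (2 * α * γ i) := fun i => norm_exp_two_mul a _
  have hsum : ∑ x : Fin m × Fin q, ((x.1 : ℝ) + 1) * r = q * r * (m * (m + 1)) / 2 := by
    rw [Fintype.sum_prod_type]
    simp only [Finset.sum_const, Finset.card_univ, Fintype.card_fin, nsmul_eq_mul]
    rw [← Finset.mul_sum, ← Finset.sum_mul]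
    have : ∀ k : ℕ, ∑ i : Fin k, ((i : ℝ) + 1) = k * (k + 1) / 2 := by
      intro k
      induction k with
      | zero => simp
      | succ k ih => rw [Fin.sum_univ_castSucc]; simp [ih]; ring
    rw [this]; ring
  have hlaur : ∀ x, ‖laurent a c (ex (Sum.elim p n x))‖ ≤ Real.exp (α * (r * m) ^ 2) * ε := by
    intro x
    have h1 := hsmall _ (habs x)
    have h2 := norm_chirp a (γ (Sum.elim p n x))
    rw [synth_eq_laurent, norm_mul] at h1
    rw [chirp] at h2
    rw [h2] at h1
    have h3 : γ (Sum.elim p n x) ^ 2 ≤ (r * m) ^ 2 := by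
      rw [sq_le_sq, abs_of_nonneg (by positivity : 0 ≤ r * (m : ℝ))]; exact habs x
    calc _ = Real.exp (α * γ (Sum.elim p n x) ^ 2) * (Real.exp (-(α * γ (Sum.elim p n x) ^ 2)) *
          ‖laurent a c (ex (Sum.elim p n x))‖) := by
          rw [← mul_assoc, ← Real.exp_add]; simp
      _ ≤ Real.exp (α * (r * m) ^ 2) * ε := by gcongr
  have hSm : S - 1 = 2 * α * (r * m) := by rw [hS]; ring
  have h2a : 0 < 2 * α := by positivity
  have hbound := hmain (ex ∘ p) (ex ∘ n) ?_ ?_ ?_ ?_ ?_ ?_ ?_ (laurent a c)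
    (Real.exp ((S + 1) ^ 2 / (4 * α)) * ∑' n : ℤ, Real.exp (-|(n : ℝ)|) * ‖c n‖)
    (Real.exp (α * (r * m) ^ 2) * ε) (differentiableOn_laurent ha hc)
    (fun x => hlaur (Sum.inl x)) (fun x => hlaur (Sum.inr x))
    (fun z hz => norm_laurent_le ha hc (hz ▸ Real.exp_le_exp.mpr (by linarith)) hz.le)
    (fun z hz => norm_laurent_le ha hc hz.ge (hz ▸ Real.exp_le_exp.mpr (by linarith)))
  · have := norm_coeff_zero_le ha hc hbound
    refine this.trans ?_
    have hM : 0 ≤ ∑' n : ℤ, Real.exp (-|(n : ℝ)|) * ‖c n‖ :=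
      tsum_nonneg fun n => by positivity
    rw [Fintype.card_prod, Fintype.card_fin, Fintype.card_fin, ← mul_assoc, ← mul_assoc]
    exact add_le_add (mul_le_mul_of_nonneg_right hm hM) le_rfl
  · intro x y hxy
    rw [← Sum.comp_elim]
    refine le_trans ?_ (abs_norm_sub_norm_le _ _)
    simp only [Function.comp, hexn]
    have hx := fun x => (abs_le.mp (habs x)).1
    have hx' : ∀ x, -S ≤ 2 * α * γ (Sum.elim p n x) := fun x => by
      have := mul_le_mul_of_nonneg_left (hx x) h2a.le
      linarith
    exact exp_sub_exp_ge ha hδ (hx' x) (hx' y) (hγ _ _ (hpn.ne hxy))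
  · intro x
    simp only [Function.comp, hexn]
    exact Real.one_le_exp (mul_nonneg h2a.le ((hlo x.1).trans (hp1 x)))
  · intro x
    simp only [Function.comp, hexn, hSm]
    exact Real.exp_le_exp.mpr (mul_le_mul_of_nonneg_left ((hp2 x).le.trans (hup x.1)) h2a.le)
  · intro x
    simp only [Function.comp, hexn]
    exact Real.exp_le_one_iff.mpr (mul_nonpos_of_nonneg_of_nonpos h2a.le (by
      linarith [hn2 x, hlo x.1]))
  · intro x
    simp only [Function.comp, hexn, hSm]
    refine Real.exp_le_exp.mpr ?_
    rw [← mul_neg]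
    exact mul_le_mul_of_nonneg_left (by linarith [hn1 x, hup x.1]) h2a.le
  · simp only [Function.comp, hexn]
    rw [← Real.exp_sum, hX, ← Finset.mul_sum]
    refine Real.exp_le_exp.mpr ?_
    calc _ ≤ 2 * α * ∑ x : Fin m × Fin q, ((x.1 : ℝ) + 1) * r := by
          gcongr with x; exact (hp2 x).le
      _ = _ := by rw [hsum]; ring
  · simp only [Function.comp, hexn, ← Real.exp_neg, ← mul_neg]
    rw [← Real.exp_sum, hX, ← Finset.mul_sum]
    refine Real.exp_le_exp.mpr ?_
    calc _ ≤ 2 * α * ∑ x : Fin m × Fin q, ((x.1 : ℝ) + 1) * r := by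
          gcongr with x; linarith [hn1 x]
      _ = _ := by rw [hsum]; ring

lemma sq_add_le_two_mul (x y : ℝ≥0∞) : (x + y) ^ 2 ≤ 2 * x ^ 2 + 2 * y ^ 2 := by
  have := ENNReal.rpow_add_le_mul_rpow_add_rpow x y (p := 2) (by norm_num)
  norm_num at this
  rw [← mul_add]
  exact this

lemma summable_exp_mul_norm {c : ℤ → ℂ} (hc : sqSum c ≠ ∞) :
    Summable fun n : ℤ => Real.exp (-|(n : ℝ)|) * ‖c n‖ := by
  obtain ⟨M, hM⟩ := norm_le_of_sqSum hc
  refine Summable.of_nonneg_of_le (fun _ => by positivity)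
    (fun n => mul_le_mul_of_nonneg_left (hM n) (Real.exp_pos _).le) (Summable.mul_right M ?_)
  simpa using summable_exp_neg_abs_sub 0

lemma exists_enorm_coeff_bound {a : ℂ} (ha : 0 < a.re) {δ r : ℝ} {q : ℕ} (hδ : 0 < δ)
    (hr : 0 < r) (hq : r < q) {θ : ℝ} (hθ : 0 < θ) :
    ∃ K : ℝ≥0∞, K ≠ ∞ ∧ ∀ (ι : Type) (γ : ι → ℝ), SepFamily δ γ → BlockDense r q γ →
      ∀ c : ℤ → ℂ, sqSum c ≠ ∞ →
        ‖c 0‖ₑ ^ 2 ≤ 2 * ENNReal.ofReal θ ^ 2 * (∑' n : ℤ, expDecay (0 - n) * ‖c n‖ₑ) ^ 2 +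
          K * ∑' i, expDecay (γ i) * ‖synth a c (γ i)‖ₑ ^ 2 := by
  obtain ⟨K, R, hK, h⟩ := exists_coeff_bound ha hδ hr hq hθ
  refine ⟨2 * ENNReal.ofReal K ^ 2 * ENNReal.ofReal (Real.exp R),
    ENNReal.mul_ne_top (ENNReal.mul_ne_top (by simp) (by simp)) (by simp), ?_⟩
  intro ι γ hγ hd c hc
  set W := ENNReal.ofReal (Real.exp R) * ∑' i, expDecay (γ i) * ‖synth a c (γ i)‖ₑ ^ 2 with hW
  have hWtop : W ≠ ∞ := by
    refine ENNReal.mul_ne_top ENNReal.ofReal_ne_top (ne_top_of_le_ne_top ?_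
      (ENNReal.tsum_le_tsum (g := fun i => ‖synth a c (γ i)‖ₑ ^ 2) fun i => ?_))
    · exact ne_top_of_le_ne_top (ENNReal.mul_ne_top (besselConst_ne_top a hδ) hc)
        (sqSum_synth_le ha hδ hγ c)
    · refine mul_le_of_le_one_left' ?_
      rw [expDecay, ← ENNReal.ofReal_one]
      exact ENNReal.ofReal_le_ofReal (Real.exp_le_one_iff.mpr (by simp))
  have hsum := summable_exp_mul_norm hc
  have hb := h ι γ hγ hd c hsum (Real.sqrt W.toReal) (Real.sqrt_nonneg _) (by
    intro i hi
    refine Real.le_sqrt_of_sq_le ?_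
    rw [← toReal_enorm, ← ENNReal.toReal_pow]
    refine ENNReal.toReal_mono hWtop ?_
    rw [hW, ← ENNReal.tsum_mul_left]
    refine le_trans ?_ (ENNReal.le_tsum i)
    rw [← mul_assoc]
    refine le_mul_of_one_le_left' ?_
    rw [expDecay, ← ENNReal.ofReal_mul (Real.exp_pos _).le, ← Real.exp_add, ← ENNReal.ofReal_one]
    exact ENNReal.ofReal_le_ofReal (Real.one_le_exp (by linarith)))
  have he : ‖c 0‖ₑ ≤ ENNReal.ofReal θ * (∑' n : ℤ, expDecay (0 - n) * ‖c n‖ₑ) +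
      ENNReal.ofReal K * ENNReal.ofReal (Real.sqrt W.toReal) := by
    refine (enorm_le_ofReal hb).trans ?_
    rw [← ENNReal.ofReal_mul hK]
    refine ENNReal.ofReal_add_le.trans ?_
    rw [ENNReal.ofReal_mul hθ.le, ENNReal.ofReal_tsum_of_nonneg (fun _ => by positivity) hsum]
    gcongr with n
    rw [ENNReal.ofReal_mul (Real.exp_pos _).le, ofReal_norm, expDecay]
    simp
  calc _ ≤ _ := pow_le_pow_left' he 2
    _ ≤ _ := sq_add_le_two_mul _ _
    _ = _ := by
        rw [mul_pow, mul_pow, ← ENNReal.ofReal_pow (Real.sqrt_nonneg _),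
          Real.sq_sqrt ENNReal.toReal_nonneg, ENNReal.ofReal_toReal hWtop, hW]
        ring

lemma le_two_mul_of_le_half_add {S T : ℝ≥0∞} (hS : S ≠ ∞) (h : S ≤ 1 / 2 * S + T) :
    S ≤ 2 * T := by
  have hhalf : S = 1 / 2 * S + 1 / 2 * S := by
    rw [← add_mul, ENNReal.add_halves, one_mul]
  have hle : 1 / 2 * S ≤ T := by
    refine ENNReal.le_of_add_le_add_left (a := 1 / 2 * S) (ENNReal.mul_ne_top (by simp) hS) ?_
    rwa [← hhalf]
  calc S = 2 * (1 / 2 * S) := by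
        rw [← mul_assoc, one_div, ENNReal.mul_inv_cancel (by simp) (by simp), one_mul]
    _ ≤ 2 * T := by gcongr

/-- Lower sampling bound, uniform over all separated families of a given supercritical density. -/
theorem exists_sqSum_le_of_blockDense {a : ℂ} (ha : 0 < a.re) {δ r : ℝ} {q : ℕ} (hδ : 0 < δ)
    (hr : 0 < r) (hq : r < q) :
    ∃ A : ℝ≥0∞, A ≠ ∞ ∧ ∀ (ι : Type) (γ : ι → ℝ), SepFamily δ γ → BlockDense r q γ →
      ∀ c : ℤ → ℂ, sqSum c ≠ ∞ → sqSum c ≤ A * sqSum (fun i => synth a c (γ i)) := by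
  set s := (sepConst 1).toReal with hs
  have hsc : sepConst 1 = ENNReal.ofReal s := (ENNReal.ofReal_toReal (sepConst_ne_top one_pos)).symm
  have hs0 : 0 ≤ s := ENNReal.toReal_nonneg
  obtain ⟨K, hK, h⟩ := exists_enorm_coeff_bound ha hδ hr hq
    (by positivity : 0 < 1 / (2 * (s + 1)))
  refine ⟨2 * (K * sepConst 1), by simp [ENNReal.mul_eq_top, hK, sepConst_ne_top one_pos], ?_⟩
  intro ι γ hγ hd c hc
  set θ := ENNReal.ofReal (1 / (2 * (s + 1))) with hθ
  have hj : ∀ j : ℤ, ‖c j‖ₑ ^ 2 ≤ 2 * θ ^ 2 * (∑' n : ℤ, expDecay ((j : ℝ) - n) * ‖c n‖ₑ) ^ 2 +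
      K * ∑' i, expDecay (γ i - j) * ‖synth a c (γ i)‖ₑ ^ 2 := by
    intro j
    have h1 := h ι (fun i => γ i + -(j : ℝ)) (hγ.add_const _) (hd.add_const _)
      (fun n => c (n + j)) (by rwa [sqSum_shift])
    have h2 : ∑' n : ℤ, expDecay (0 - n) * ‖c (n + j)‖ₑ =
        ∑' n : ℤ, expDecay ((j : ℝ) - n) * ‖c n‖ₑ := by
      rw [← (Equiv.addRight j).tsum_eq fun n : ℤ => expDecay ((j : ℝ) - n) * ‖c n‖ₑ]
      refine tsum_congr fun n => ?_
      simp
    simp only [h2, ← synth_add_int, zero_add, ← sub_eq_add_neg, sub_add_cancel] at h1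
    exact h1
  have hsmall : 2 * θ ^ 2 * (sepConst 1 * sepConst 1) ≤ 1 / 2 := by
    rw [hsc, hθ, ← ENNReal.ofReal_mul hs0, ← ENNReal.ofReal_pow (by positivity),
      ← ENNReal.ofReal_ofNat 2, ← ENNReal.ofReal_mul (by norm_num),
      ← ENNReal.ofReal_mul (by positivity), ← ENNReal.ofReal_one,
      ← ENNReal.ofReal_div_of_pos (by norm_num)]
    refine ENNReal.ofReal_le_ofReal ?_
    rw [div_pow, one_pow, mul_one_div, div_mul_eq_mul_div, div_le_div_iff₀ (by positivity)
      (by norm_num)]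
    nlinarith
  have htot : sqSum c ≤ 1 / 2 * sqSum c + K * sepConst 1 * sqSum (fun i => synth a c (γ i)) := by
    calc sqSum c ≤ ∑' j : ℤ, (2 * θ ^ 2 * (∑' n : ℤ, expDecay ((j : ℝ) - n) * ‖c n‖ₑ) ^ 2 +
          K * ∑' i, expDecay (γ i - j) * ‖synth a c (γ i)‖ₑ ^ 2) := ENNReal.tsum_le_tsum hj
      _ = 2 * θ ^ 2 * ∑' j : ℤ, (∑' n : ℤ, expDecay ((j : ℝ) - n) * ‖c n‖ₑ) ^ 2 +
          K * ∑' i, (∑' j : ℤ, expDecay (γ i - j)) * ‖synth a c (γ i)‖ₑ ^ 2 := by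
          rw [ENNReal.tsum_add, ENNReal.tsum_mul_left, ENNReal.tsum_mul_left, ENNReal.tsum_comm]
          simp_rw [ENNReal.tsum_mul_right]
      _ ≤ 2 * θ ^ 2 * (sepConst 1 * sepConst 1 * sqSum c) +
          K * ∑' i, sepConst 1 * ‖synth a c (γ i)‖ₑ ^ 2 := by
          gcongr with i
          · exact expDecay_schur one_pos sepFamily_int _
          · exact tsum_expDecay_int_le _
      _ ≤ _ := by
          rw [ENNReal.tsum_mul_left, ← mul_assoc, ← mul_assoc K]
          exact add_le_add (mul_le_mul_left hsmall _) le_rfl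
  refine (le_two_mul_of_le_half_add hc htot).trans_eq ?_
  ring

lemma exists_blockDense_of_lowerDensity {Λ : Set ℝ} (h : 1 < lowerDensity Λ) :
    ∃ (r : ℝ) (q : ℕ), 0 < r ∧ r < q ∧ BlockDense r q (Subtype.val : Λ → ℝ) := by
  obtain ⟨ρ, hρ1, hρ⟩ := exists_between h
  have hev := eventually_lt_of_lt_liminf (f := atTop) hρ ⟨0, by
    rw [eventually_map]
    filter_upwards [eventually_gt_atTop 0] with r hr
    exact Real.iInf_nonneg fun x => by positivity⟩
  obtain ⟨r, hr1, hr2, hr3⟩ := (hev.and ((eventually_gt_atTop 0).and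
    (eventually_ge_atTop (2 / (ρ - 1))))).exists
  have hr4 : r + 2 ≤ ρ * r := by
    rw [div_le_iff₀ (by linarith)] at hr3; linarith
  refine ⟨r + 1, ⌊r⌋₊ + 2, by linarith, ?_, fun x => ?_⟩
  · push_cast; linarith [Nat.lt_floor_add_one r]
  have hx : ρ < ((Λ ∩ Set.Icc x (x + r)).ncard : ℝ) / r :=
    hr1.trans_le (ciInf_le ⟨0, by rintro _ ⟨y, rfl⟩; positivity⟩ x)
  rw [lt_div_iff₀ hr2] at hx
  have hfin : (Λ ∩ Set.Icc x (x + r)).Finite := by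
    refine Set.finite_of_ncard_pos ?_
    have : (0 : ℝ) < ((Λ ∩ Set.Icc x (x + r)).ncard : ℝ) := by nlinarith
    exact_mod_cast this
  have hcard : ⌊r⌋₊ + 2 ≤ hfin.toFinset.card := by
    rw [← Set.ncard_eq_toFinset_card _ hfin]
    have : ((⌊r⌋₊ + 2 : ℕ) : ℝ) ≤ ((Λ ∩ Set.Icc x (x + r)).ncard : ℝ) := by
      push_cast; linarith [Nat.floor_le hr2.le]
    exact_mod_cast this
  obtain ⟨t, ht, htc⟩ := Finset.exists_subset_card_eq hcard
  have hmem : ∀ i, ((t.equivFinOfCardEq htc).symm i : ℝ) ∈ Λ ∩ Set.Icc x (x + r) := fun i =>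
    hfin.mem_toFinset.mp (ht ((t.equivFinOfCardEq htc).symm i).2)
  refine ⟨fun i => ⟨_, (hmem i).1⟩, fun i j hij => ?_, fun i => ⟨(hmem i).2.1, ?_⟩⟩
  · exact (t.equivFinOfCardEq htc).symm.injective (Subtype.ext (by simpa using hij))
  · have := (hmem i).2.2
    simp only
    linarith

lemma separated_inter_Icc {Λ : Set ℝ} {δ : ℝ} (hδ : 0 < δ)
    (hΛ : ∀ x ∈ Λ, ∀ y ∈ Λ, x ≠ y → δ ≤ |x - y|) (u v : ℝ) :
    (Λ ∩ Set.Icc u v).Finite ∧ (u ≤ v → ((Λ ∩ Set.Icc u v).ncard : ℝ) ≤ (v - u) / δ + 1) := by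
  have hmap : ∀ x ∈ Λ ∩ Set.Icc u v, ⌊(x - u) / δ⌋ ∈ (Finset.Icc 0 ⌊(v - u) / δ⌋ : Set ℤ) := by
    rintro x ⟨-, hx1, hx2⟩
    simp only [Finset.coe_Icc, Set.mem_Icc]
    refine ⟨Int.floor_nonneg.mpr (div_nonneg (by linarith) hδ.le), Int.floor_mono ?_⟩
    gcongr
  have hinj : Set.InjOn (fun x => ⌊(x - u) / δ⌋) (Λ ∩ Set.Icc u v) := by
    intro x hx y hy hxy
    by_contra hne
    have h1 := Int.abs_sub_lt_one_of_floor_eq_floor hxy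
    have h2 : (x - u) / δ - (y - u) / δ = (x - y) / δ := by ring
    rw [h2, abs_div, abs_of_pos hδ, div_lt_one hδ] at h1
    exact absurd (hΛ x hx.1 y hy.1 hne) (not_le.mpr h1)
  refine ⟨Set.Finite.of_injOn hmap hinj (Finset.finite_toSet _), fun huv => ?_⟩
  have h1 := Set.ncard_le_ncard_of_injOn _ hmap hinj (Finset.finite_toSet _)
  rw [Set.ncard_coe_finset, Int.card_Icc] at h1
  have h0 : 0 ≤ ⌊(v - u) / δ⌋ := Int.floor_nonneg.mpr (div_nonneg (by linarith) hδ.le)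
  have h2 : ((Λ ∩ Set.Icc u v).ncard : ℤ) ≤ ⌊(v - u) / δ⌋ + 1 := by omega
  have h3 : ((Λ ∩ Set.Icc u v).ncard : ℝ) ≤ ⌊(v - u) / δ⌋ + 1 := by exact_mod_cast h2
  linarith [Int.floor_le ((v - u) / δ)]

lemma one_lt_lowerDensity {Λ : Set ℝ} (hΛ : Separated Λ) {τ C : ℝ} (hτ : 0 < τ)
    (h : ∀ x r : ℝ, 0 < r → (1 + τ) * r - C ≤ (Λ ∩ Set.Icc x (x + r)).ncard) :
    1 < lowerDensity Λ := by
  obtain ⟨δ, hδ, hsep⟩ := hΛ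
  refine lt_of_lt_of_le (by linarith : 1 < 1 + τ / 2) (le_liminf_of_le ?_ ?_)
  · refine IsCoboundedUnder.of_frequently_le (a := 1 / δ + 1) (Eventually.frequently ?_)
    filter_upwards [eventually_ge_atTop 1] with r hr
    refine (ciInf_le ⟨0, by rintro _ ⟨y, rfl⟩; positivity⟩ (0 : ℝ)).trans ?_
    have := (separated_inter_Icc hδ hsep 0 (0 + r)).2 (by linarith)
    rw [div_le_iff₀ (by linarith)]
    refine this.trans ?_
    have h2 : (0 + r - 0) / δ = 1 / δ * r := by ring
    rw [h2]; nlinarith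
  · filter_upwards [eventually_gt_atTop 0, eventually_ge_atTop (2 * C / τ)] with r hr hr2
    refine le_ciInf fun x => ?_
    rw [div_le_iff₀ hτ] at hr2
    rw [le_div_iff₀ hr]
    linarith [h x r hr]

lemma lintegral_eq_lintegral_Ioc_tsum {h : ℝ → ℝ≥0∞} (hh : Measurable h) (t₀ : ℝ) :
    ∫⁻ x, h x = ∫⁻ t in Set.Ioc t₀ (t₀ + 1), ∑' k : ℤ, h (t + k) := by
  rw [lintegral_tsum (f := fun (k : ℤ) t => h (t + k))
      fun k => (hh.comp (measurable_add_const (k : ℝ))).aemeasurable,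
    ← setLIntegral_univ, ← iUnion_Ioc_add_intCast t₀,
    lintegral_iUnion (fun _ => measurableSet_Ioc) (Set.pairwise_disjoint_Ioc_add_intCast t₀)]
  refine tsum_congr fun k => ?_
  have := (measurePreserving_add_right (volume : Measure ℝ) (k : ℝ)).setLIntegral_comp_preimage
    (measurableSet_Ioc (a := t₀ + k) (b := t₀ + k + 1)) hh
  rw [← this]
  congr 2
  ext x
  simp only [Set.mem_preimage, Set.mem_Ioc]
  constructor <;> rintro ⟨h1, h2⟩ <;> constructor <;> linarith

lemma continuous_chirp (a : ℂ) : Continuous (chirp a) := by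
  unfold chirp; fun_prop

lemma measurable_synth (a : ℂ) (c : ℤ → ℂ) : Measurable (synth a c) := by
  unfold synth
  refine Measurable.tsum fun n => ?_
  exact (((continuous_chirp a).comp (continuous_sub_right (n : ℝ))).measurable).const_mul _

lemma measurable_enorm_synth_sq (a : ℂ) (c : ℤ → ℂ) : Measurable fun x => ‖synth a c x‖ₑ ^ 2 :=
  (measurable_synth a c).enorm.pow_const 2

lemma lintegral_synth_le {a : ℂ} (ha : 0 < a.re) (c : ℤ → ℂ) :
    ∫⁻ x, ‖synth a c x‖ₑ ^ 2 ≤ besselConst a 1 * sqSum c := by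
  rw [lintegral_eq_lintegral_Ioc_tsum (measurable_enorm_synth_sq a c) 0]
  calc _ ≤ ∫⁻ _t in Set.Ioc (0 : ℝ) (0 + 1), besselConst a 1 * sqSum c := by
        refine lintegral_mono fun t => ?_
        have := sqSum_synth_le ha one_pos (sepFamily_int.add_const t) c
        simpa only [sqSum, add_comm] using this
    _ = _ := by simp

/-- The half-integers, listed as two copies of the integers. -/
def halfInt : ℤ ⊕ ℤ → ℝ := Sum.elim (fun n => (n : ℝ)) (fun n => (n : ℝ) + 1 / 2)

lemma sepFamily_halfInt : SepFamily (1 / 2) halfInt := by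
  have h2 : ∀ x : ℤ ⊕ ℤ, ∃ k : ℤ, halfInt x = k / 2 := by
    rintro (n | n)
    · exact ⟨2 * n, by simp [halfInt]⟩
    · exact ⟨2 * n + 1, by simp [halfInt]; ring⟩
  have hinj : Function.Injective halfInt := by
    rintro (n | n) (k | k) h <;> simp only [halfInt, Sum.elim_inl, Sum.elim_inr] at h
    · rw [Int.cast_injective h]
    · have : (2 * n : ℤ) = 2 * k + 1 := by
        have : (2 * n : ℝ) = 2 * k + 1 := by linarith
        exact_mod_cast this
      omega
    · have : (2 * n + 1 : ℤ) = 2 * k := by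
        have : (2 * n + 1 : ℝ) = 2 * k := by linarith
        exact_mod_cast this
      omega
    · rw [Int.cast_injective (by linarith : (n : ℝ) = k)]
  intro x y hxy
  obtain ⟨k, hk⟩ := h2 x
  obtain ⟨l, hl⟩ := h2 y
  have hkl : k ≠ l := fun h => hxy (hinj (by rw [hk, hl, h]))
  have := sepFamily_int k l hkl
  rw [hk, hl, ← sub_div, abs_div, abs_two]
  linarith

lemma blockDense_halfInt : BlockDense 1 2 halfInt := by
  intro x
  refine ⟨![Sum.inl ⌈x⌉, Sum.inr ⌈x - 1 / 2⌉], ?_, ?_⟩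
  · intro i j
    fin_cases i <;> fin_cases j <;> simp
  · intro i
    fin_cases i
    · simp only [halfInt, Fin.zero_eta, Matrix.cons_val_zero, Sum.elim_inl]
      exact ⟨Int.le_ceil x, Int.ceil_lt_add_one x⟩
    · simp only [halfInt, Fin.mk_one, Matrix.cons_val_one, Matrix.cons_val_fin_one, Sum.elim_inr]
      have h1 := Int.le_ceil (x - 1 / 2)
      have h2 := Int.ceil_lt_add_one (x - 1 / 2)
      exact ⟨by linarith, by linarith⟩

/-- The lower Riesz bound for the integer translates of the chirped Gaussian. -/
lemma exists_sqSum_le_lintegral_synth {a : ℂ} (ha : 0 < a.re) :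
    ∃ A : ℝ≥0∞, A ≠ ∞ ∧ ∀ c : ℤ → ℂ, sqSum c ≠ ∞ →
      sqSum c ≤ A * ∫⁻ x, ‖synth a c x‖ₑ ^ 2 := by
  obtain ⟨A, hA, h⟩ := exists_sqSum_le_of_blockDense ha (δ := 1 / 2) (r := 1) (q := 2)
    (by norm_num) one_pos (by norm_num)
  refine ⟨A * 2, ENNReal.mul_ne_top hA (by simp), fun c hc => ?_⟩
  have hm := measurable_enorm_synth_sq a c
  have hm' : Measurable fun x => ‖synth a c (x + 1 / 2)‖ₑ ^ 2 :=
    hm.comp (measurable_add_const _)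
  have hshift : ∫⁻ x, ‖synth a c (x + 1 / 2)‖ₑ ^ 2 = ∫⁻ x, ‖synth a c x‖ₑ ^ 2 :=
    lintegral_add_right_eq_self (μ := volume) (fun x => ‖synth a c x‖ₑ ^ 2) (1 / 2 : ℝ)
  have hmt : Measurable fun t : ℝ => ∑' k : ℤ, ‖synth a c (t + k)‖ₑ ^ 2 :=
    Measurable.tsum fun k => hm.comp (measurable_add_const _)
  have hmt' : Measurable fun t : ℝ => ∑' k : ℤ, ‖synth a c (t + k + 1 / 2)‖ₑ ^ 2 :=
    Measurable.tsum fun k => hm'.comp (measurable_add_const _)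
  calc sqSum c = ∫⁻ _t in Set.Ioc (0 : ℝ) (0 + 1), sqSum c := by simp
    _ ≤ ∫⁻ t in Set.Ioc (0 : ℝ) (0 + 1), A * (∑' k : ℤ, ‖synth a c (t + k)‖ₑ ^ 2 +
          ∑' k : ℤ, ‖synth a c (t + k + 1 / 2)‖ₑ ^ 2) := by
        refine lintegral_mono fun t => ?_
        refine (h _ _ (sepFamily_halfInt.add_const t) (blockDense_halfInt.add_const t) c hc).trans
          (le_of_eq ?_)
        rw [sqSum, Summable.tsum_sum ENNReal.summable ENNReal.summable]
        simp only [halfInt, Sum.elim_inl, Sum.elim_inr]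
        congr 2
        · exact tsum_congr fun k => by rw [add_comm]
        · exact tsum_congr fun k => by congr 3; ring
    _ = A * ((∫⁻ x, ‖synth a c x‖ₑ ^ 2) + ∫⁻ x, ‖synth a c (x + 1 / 2)‖ₑ ^ 2) := by
        rw [lintegral_const_mul _ (by fun_prop), lintegral_add_left hmt,
          ← lintegral_eq_lintegral_Ioc_tsum hm, ← lintegral_eq_lintegral_Ioc_tsum hm']
    _ = _ := by rw [hshift]; ring

lemma toReal_sqSum {κ : Type} (c : κ → ℂ) : (sqSum c).toReal = ∑' n, ‖c n‖ ^ 2 := by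
  rw [sqSum, ENNReal.tsum_toReal_eq fun n => ENNReal.pow_ne_top enorm_ne_top]
  simp [ENNReal.toReal_pow]

lemma toReal_lintegral_enorm_sq {f : ℝ → ℂ} (hf : AEStronglyMeasurable f volume) :
    (∫⁻ t, ‖f t‖ₑ ^ 2).toReal = ∫ t, ‖f t‖ ^ 2 := by
  rw [integral_eq_lintegral_of_nonneg_ae (f := fun t => ‖f t‖ ^ 2)
    (Eventually.of_forall fun t => by positivity) (hf.norm.pow 2)]
  congr 1
  refine lintegral_congr fun t => ?_
  rw [ENNReal.ofReal_pow (norm_nonneg _), ofReal_norm]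

lemma memℓp_two_iff_sqSum {c : ℤ → ℂ} : Memℓp c 2 ↔ sqSum c ≠ ∞ := by
  rw [memℓp_gen_iff (by norm_num), ENNReal.toReal_ofNat]
  constructor
  · intro h
    have : sqSum c = ENNReal.ofReal (∑' n, ‖c n‖ ^ (2 : ℝ)) := by
      rw [ENNReal.ofReal_tsum_of_nonneg (fun _ => by positivity) h]
      refine tsum_congr fun n => ?_
      rw [Real.rpow_two, ENNReal.ofReal_pow (norm_nonneg _), ofReal_norm]
    rw [this]; exact ENNReal.ofReal_ne_top
  · intro h
    refine (ENNReal.summable_toReal h).congr fun n => ?_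
    simp [ENNReal.toReal_pow]

lemma toReal_le_of_le_mul {x y K : ℝ≥0∞} (hK : K ≠ ∞) (hy : y ≠ ∞) (h : x ≤ K * y) :
    x.toReal ≤ (K.toReal + 1) * y.toReal := by
  have := ENNReal.toReal_mono (ENNReal.mul_ne_top hK hy) h
  rw [ENNReal.toReal_mul] at this
  linarith [ENNReal.toReal_nonneg (a := y)]

lemma inv_mul_toReal_le_of_le_mul {x y K : ℝ≥0∞} (hK : K ≠ ∞) (hy : y ≠ ∞) (h : x ≤ K * y) :
    (K.toReal + 1)⁻¹ * x.toReal ≤ y.toReal := by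
  have h0 : 0 < K.toReal + 1 := by positivity
  rw [inv_mul_le_iff₀ h0]
  exact toReal_le_of_le_mul hK hy h

/-- A uniform lower sampling bound for all translates, tested on finitely supported sequences. -/
def UniformLower {ι : Type} (a : ℂ) (A : ℝ≥0∞) (γ : ι → ℝ) : Prop :=
  ∀ (x : ℝ) (c : ℤ → ℂ), c.support.Finite →
    sqSum c ≤ A * sqSum (fun i => synth a c (γ i + x))

lemma sqSum_ne_top_of_finite {c : ℤ → ℂ} (hc : c.support.Finite) : sqSum c ≠ ∞ := by
  rw [sqSum, tsum_eq_sum (s := hc.toFinset) fun n hn => by simpa using hn]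
  exact ENNReal.sum_ne_top.mpr fun n _ => ENNReal.pow_ne_top enorm_ne_top

lemma inV2_iff {a : ℂ} (ha : 0 < a.re) {g : ℝ → ℂ} (hg : g = chirp a) {f : ℝ → ℂ} :
    InV2 g f ↔ ∃ c : ℤ → ℂ, sqSum c ≠ ∞ ∧ f = synth a c := by
  subst hg
  refine exists_congr fun c => ?_
  rw [memℓp_two_iff_sqSum]
  refine and_congr_right fun hc => ⟨fun h => funext fun x => (h x).tsum_eq.symm, ?_⟩
  rintro rfl x
  exact (summable_synth ha hc x).hasSum

lemma tsum_image_add (Λ : Set ℝ) (x : ℝ) (f : ℝ → ℂ) :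
    ∑' l : ((fun t => t + x) '' Λ : Set ℝ), ‖f l‖ ^ 2 = ∑' l : Λ, ‖f (l + x)‖ ^ 2 :=
  tsum_image (fun t => ‖f t‖ ^ 2) (add_left_injective x).injOn

lemma isSamplingSet_of_lower_bound {a : ℂ} (ha : 0 < a.re) {Λ : Set ℝ} {δ : ℝ} (hδ : 0 < δ)
    (hΛ : SepFamily δ (Subtype.val : Λ → ℝ)) {A : ℝ≥0∞} (hA : A ≠ ∞) (x : ℝ)
    (h : ∀ c : ℤ → ℂ, sqSum c ≠ ∞ → sqSum c ≤ A * sqSum (fun l : Λ => synth a c (l + x))) :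
    IsSamplingSet (chirp a) ((fun t => t + x) '' Λ) := by
  obtain ⟨R, hR, hRiesz⟩ := exists_sqSum_le_lintegral_synth ha
  have hB1 := besselConst_ne_top a one_pos
  have hBδ := besselConst_ne_top a hδ
  refine ⟨((besselConst a 1 * A).toReal + 1)⁻¹, (besselConst a δ * R).toReal + 1, by positivity,
    by positivity, fun f hf => ?_⟩
  obtain ⟨c, hc, rfl⟩ := (inV2_iff ha rfl).mp hf
  have h1 := lintegral_synth_le ha c
  have h2 := sqSum_synth_le ha hδ (hΛ.add_const x) c
  rw [tsum_image_add, ← toReal_sqSum (fun l : Λ => synth a c (l + x)),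
    ← toReal_lintegral_enorm_sq (measurable_synth a c).aestronglyMeasurable]
  constructor
  · refine inv_mul_toReal_le_of_le_mul (ENNReal.mul_ne_top hB1 hA)
      (ne_top_of_le_ne_top (ENNReal.mul_ne_top hBδ hc) h2) (h1.trans ?_)
    rw [mul_assoc]; gcongr; exact h c hc
  · refine toReal_le_of_le_mul (ENNReal.mul_ne_top hBδ hR)
      (ne_top_of_le_ne_top (ENNReal.mul_ne_top hB1 hc) h1) (h2.trans ?_)
    rw [mul_assoc]; gcongr; exact hRiesz c hc

lemma sqSum_le_two_mul_add {κ : Type} (u v : κ → ℂ) :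
    sqSum u ≤ 2 * sqSum v + 2 * sqSum fun i => u i - v i := by
  rw [sqSum, sqSum, sqSum, ← ENNReal.tsum_mul_left, ← ENNReal.tsum_mul_left, ← ENNReal.tsum_add]
  refine ENNReal.tsum_le_tsum fun i => ?_
  refine le_trans (pow_le_pow_left' ?_ 2) (sq_add_le_two_mul _ _)
  simpa using enorm_add_le (v i) (u i - v i)

lemma sqSum_synth_sub_le {a : ℂ} (ha : 0 < a.re) {ι : Type} {δ : ℝ} (hδ : 0 < δ) {γ : ι → ℝ}
    (hγ : SepFamily δ γ) {c : ℤ → ℂ} (hc : sqSum c ≠ ∞) {h s t : ℝ} (hst : |s - t| ≤ h)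
    (h1 : h ≤ 1) :
    sqSum (fun i => synth a c (γ i + s) - synth a c (γ i + t)) ≤
      ENNReal.ofReal (chirpLip a * h) ^ 2 * (sepConst 1 * sepConst δ) * sqSum c := by
  refine tsum_enorm_sq_le_of_kernel hδ (hγ.add_const t) (b := fun n => ‖c n‖ₑ) fun i => ?_
  rw [synth, synth, ← (summable_synth ha hc _).tsum_sub (summable_synth ha hc _)]
  refine enorm_tsum_le_tsum_enorm.trans (ENNReal.tsum_le_tsum fun n => ?_)
  rw [← mul_sub, enorm_mul, mul_comm]
  gcongr
  rw [expDecay, ← ENNReal.ofReal_mul (mul_nonneg (chirpLip_nonneg a) ((abs_nonneg _).trans hst))]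
  refine enorm_le_ofReal ?_
  have hd : γ i + s - (n : ℝ) - (γ i + t - n) = s - t := by ring
  refine (norm_chirp_sub_le ha (by rw [hd]; exact hst.trans h1)).trans ?_
  rw [hd]
  have h0 : 0 ≤ h := (abs_nonneg _).trans hst
  have := mul_nonneg (chirpLip_nonneg a) h0
  gcongr
  · exact chirpLip_nonneg a
  linarith [abs_nonneg (γ i + t - (n : ℝ))]

lemma exists_sqSum_synth_perturb {a : ℂ} (ha : 0 < a.re) {δ : ℝ} (hδ : 0 < δ) {ε : ℝ≥0∞}
    (hε : ε ≠ 0) :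
    ∃ h : ℝ, 0 < h ∧ h ≤ 1 ∧ ∀ (ι : Type) (γ : ι → ℝ), SepFamily δ γ → ∀ s t : ℝ, |s - t| ≤ h →
      ∀ c : ℤ → ℂ, sqSum c ≠ ∞ → sqSum (fun i => synth a c (γ i + s)) ≤
        2 * sqSum (fun i => synth a c (γ i + t)) + ε * sqSum c := by
  set k := (sepConst 1 * sepConst δ).toReal with hk
  have hkt : sepConst 1 * sepConst δ ≠ ∞ :=
    ENNReal.mul_ne_top (sepConst_ne_top one_pos) (sepConst_ne_top hδ)
  have hm0 : 0 < (min ε 1).toReal :=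
    ENNReal.toReal_pos (by simp [hε]) (ne_top_of_le_ne_top ENNReal.one_ne_top (min_le_right _ _))
  have hcont : Tendsto (fun h : ℝ => 2 * (chirpLip a * h) ^ 2 * k) (nhdsWithin 0 (Set.Ioi 0))
      (nhds 0) := by
    have : Continuous fun h : ℝ => 2 * (chirpLip a * h) ^ 2 * k := by fun_prop
    simpa using (this.tendsto 0).mono_left nhdsWithin_le_nhds
  obtain ⟨h, hh, h0, h1⟩ := ((hcont.eventually_le_const hm0).and
    (Ioc_mem_nhdsGT (one_pos : (0 : ℝ) < 1))).exists
  refine ⟨h, h0, h1, fun ι γ hγ s t hst c hc => ?_⟩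
  refine (sqSum_le_two_mul_add _ (fun i => synth a c (γ i + t))).trans ?_
  refine add_le_add le_rfl ?_
  refine (mul_le_mul_right (sqSum_synth_sub_le ha hδ hγ hc hst h1) 2).trans ?_
  rw [← mul_assoc]
  refine mul_le_mul_left ?_ _
  rw [← ENNReal.ofReal_toReal hkt, ← hk,
    ← ENNReal.ofReal_pow (mul_nonneg (chirpLip_nonneg a) h0.le),
    ← ENNReal.ofReal_ofNat 2, ← ENNReal.ofReal_mul (by positivity),
    ← ENNReal.ofReal_mul (by positivity), ← mul_assoc]
  refine (ENNReal.ofReal_le_ofReal hh).trans ?_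
  exact ENNReal.ofReal_toReal_le.trans (min_le_left _ _)

lemma exists_lower_bound_of_isSamplingSet {a : ℂ} (ha : 0 < a.re) {Λ : Set ℝ} {x : ℝ}
    (h : IsSamplingSet (chirp a) ((fun t => t + x) '' Λ)) :
    ∃ A : ℝ≥0∞, A ≠ ∞ ∧ ∀ c : ℤ → ℂ, sqSum c ≠ ∞ →
      sqSum c ≤ A * sqSum (fun l : Λ => synth a c (l + x)) := by
  obtain ⟨R, hR, hRiesz⟩ := exists_sqSum_le_lintegral_synth ha
  obtain ⟨A, B, hA, hB, hAB⟩ := h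
  refine ⟨R * ENNReal.ofReal A⁻¹, ENNReal.mul_ne_top hR ENNReal.ofReal_ne_top, fun c hc => ?_⟩
  refine (hRiesz c hc).trans ?_
  rw [mul_assoc]
  gcongr
  have h1 := (hAB (synth a c) ((inV2_iff ha rfl).mpr ⟨c, hc, rfl⟩)).1
  have hfin : ∫⁻ t, ‖synth a c t‖ₑ ^ 2 ≠ ∞ :=
    ne_top_of_le_ne_top (ENNReal.mul_ne_top (besselConst_ne_top a one_pos) hc)
      (lintegral_synth_le ha c)
  rw [tsum_image_add, ← toReal_sqSum (fun l : Λ => synth a c (l + x)),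
    ← toReal_lintegral_enorm_sq (measurable_synth a c).aestronglyMeasurable,
    ← le_inv_mul_iff₀ hA] at h1
  rw [← ENNReal.ofReal_toReal hfin]
  refine (ENNReal.ofReal_le_ofReal h1).trans ?_
  rw [ENNReal.ofReal_mul (by positivity)]
  gcongr
  exact ENNReal.ofReal_toReal_le

lemma exists_uniformLower_of_isSamplingSet {a : ℂ} (ha : 0 < a.re) {Λ : Set ℝ} {δ : ℝ}
    (hδ : 0 < δ) (hΛ : SepFamily δ (Subtype.val : Λ → ℝ))
    (h : ∀ x : ℝ, IsSamplingSet (chirp a) ((fun t => t + x) '' Λ)) :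
    ∃ A : ℝ≥0∞, A ≠ ∞ ∧ UniformLower a A (Subtype.val : Λ → ℝ) := by
  have hloc : ∃ A : ℝ≥0∞, A ≠ ∞ ∧ ∀ x ∈ Set.Icc (0 : ℝ) 1, ∀ c : ℤ → ℂ, sqSum c ≠ ∞ →
      sqSum c ≤ A * sqSum (fun l : Λ => synth a c (l + x)) := by
    refine isCompact_Icc.induction_on (p := fun s => ∃ A : ℝ≥0∞, A ≠ ∞ ∧ ∀ x ∈ s, ∀ c : ℤ → ℂ,
      sqSum c ≠ ∞ → sqSum c ≤ A * sqSum (fun l : Λ => synth a c (l + x))) ?_ ?_ ?_ ?_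
    · exact ⟨0, by simp, by simp⟩
    · rintro s t hst ⟨A, hA, hA'⟩
      exact ⟨A, hA, fun x hx => hA' x (hst hx)⟩
    · rintro s t ⟨A, hA, hA'⟩ ⟨B, hB, hB'⟩
      refine ⟨A + B, by simp [hA, hB], ?_⟩
      rintro x (hx | hx) c hc
      · exact (hA' x hx c hc).trans (mul_le_mul_left le_self_add _)
      · exact (hB' x hx c hc).trans (mul_le_mul_left le_add_self _)
    · intro x _
      obtain ⟨A, hA, hA'⟩ := exists_lower_bound_of_isSamplingSet ha (h x)
      obtain ⟨r, hr0, -, hr⟩ := exists_sqSum_synth_perturb ha hδ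
        (ε := (2 * (A + 1))⁻¹) (by simp [ENNReal.mul_eq_top, hA])
      refine ⟨Metric.ball x r, mem_nhdsWithin_of_mem_nhds (Metric.ball_mem_nhds x hr0),
        2 * (A * 2), by simp [ENNReal.mul_eq_top, hA], fun y hy c hc => ?_⟩
      rw [mul_assoc]
      refine le_two_mul_of_le_half_add hc ((hA' c hc).trans ?_)
      rw [Metric.mem_ball, dist_comm, Real.dist_eq] at hy
      calc _ ≤ A * (2 * sqSum (fun l : Λ => synth a c (l + y)) + (2 * (A + 1))⁻¹ * sqSum c) := by
            gcongr; exact hr _ _ hΛ _ _ hy.le c hc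
        _ = (A * (2 * (A + 1))⁻¹) * sqSum c + A * 2 * sqSum (fun l : Λ => synth a c (l + y)) := by
            ring
        _ ≤ _ := by
            gcongr
            rw [ENNReal.mul_inv (by simp) (by simp), mul_left_comm, one_div]
            refine mul_le_of_le_one_right' ?_
            exact (mul_le_mul_left le_self_add _).trans (ENNReal.mul_inv_le_one _)
  obtain ⟨A, hA, hA'⟩ := hloc
  refine ⟨A, hA, fun x c hc => ?_⟩
  have hc' := sqSum_ne_top_of_finite hc
  have := hA' (Int.fract x) ⟨Int.fract_nonneg x, (Int.fract_lt_one x).le⟩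
    (fun n => c (n + ⌊x⌋)) (by rwa [sqSum_shift])
  simp only [sqSum_shift, ← synth_add_int, add_assoc, Int.fract_add_floor] at this
  exact this

lemma integral_eq_integral_Ioc_tsum {F : ℝ → ℂ} (hF : Integrable F) (hFm : Measurable F) (t₀ : ℝ) :
    ∫ x, F x = ∫ t in Set.Ioc t₀ (t₀ + 1), ∑' k : ℤ, F (t + k) := by
  have hm : ∀ k : ℤ, Measurable fun t => F (t + k) := fun k => hFm.comp (measurable_add_const (k : ℝ))
  rw [integral_tsum fun k => (hm k).aestronglyMeasurable]
  · rw [← setIntegral_univ, ← iUnion_Ioc_add_intCast t₀,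
      integral_iUnion (fun _ => measurableSet_Ioc) (Set.pairwise_disjoint_Ioc_add_intCast t₀)
        hF.integrableOn]
    refine tsum_congr fun k => ?_
    rw [← (measurePreserving_add_right (volume : Measure ℝ) (k : ℝ)).setIntegral_preimage_emb
      (measurableEmbedding_addRight _)]
    congr 2
    ext x
    simp only [Set.mem_preimage, Set.mem_Ioc]
    constructor <;> rintro ⟨h1, h2⟩ <;> constructor <;> linarith
  · rw [← lintegral_tsum fun k => (hm k).enorm.aemeasurable,
      ← lintegral_eq_lintegral_Ioc_tsum hFm.enorm]
    exact hF.2.ne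

/-- The conjugated samples of `f` on `t + ℤ`. -/
def fiber (f : ℝ → ℂ) (t : ℝ) (n : ℤ) : ℂ := (starRingEnd ℂ) (f (t + n))

lemma lintegral_sqSum_fiber {f : ℝ → ℂ} (hf : Measurable f) (t₀ : ℝ) :
    ∫⁻ t in Set.Ioc t₀ (t₀ + 1), sqSum (fiber f t) = ∫⁻ t, ‖f t‖ₑ ^ 2 := by
  rw [lintegral_eq_lintegral_Ioc_tsum (hf.enorm.pow_const 2) t₀]
  simp [sqSum, fiber]

lemma measurable_synth_fiber (a : ℂ) {f : ℝ → ℂ} (hf : Measurable f) (l : ℝ) :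
    Measurable fun t => synth a (fiber f t) (l - t) := by
  unfold synth fiber
  refine Measurable.tsum fun n => ?_
  refine ((Complex.continuous_conj.measurable.comp (hf.comp (measurable_add_const _)))).mul ?_
  exact (continuous_chirp a).measurable.comp (by fun_prop)

lemma enorm_synth_sq_le {a : ℂ} (ha : 0 < a.re) (c : ℤ → ℂ) (x : ℝ) :
    ‖synth a c x‖ₑ ^ 2 ≤ besselConst a 1 * sqSum c := by
  have h := sqSum_synth_le ha one_pos (γ := fun _ : Unit => x)
    (fun i j hij => absurd (Subsingleton.elim i j) hij) c
  simpa [sqSum] using h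

lemma lintegral_synth_fiber_le {a : ℂ} (ha : 0 < a.re) {f : ℝ → ℂ} (hf : Measurable f) (l t₀ : ℝ) :
    ∫⁻ t in Set.Ioc t₀ (t₀ + 1), ‖synth a (fiber f t) (l - t)‖ₑ ^ 2 ≤
      besselConst a 1 * ∫⁻ t, ‖f t‖ₑ ^ 2 := by
  rw [← lintegral_sqSum_fiber hf t₀, ← lintegral_const_mul' _ _ (besselConst_ne_top a one_pos)]
  exact lintegral_mono fun t => enorm_synth_sq_le ha _ _

lemma lintegral_enorm_sq_ne_top {f : ℝ → ℂ} (hf : MemLp f 2 volume) : ∫⁻ t, ‖f t‖ₑ ^ 2 ≠ ∞ := by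
  have := hf.2
  rw [eLpNorm_lt_top_iff_lintegral_rpow_enorm_lt_top (by simp) (by simp)] at this
  simpa using this.ne

lemma memLp_two_of_lintegral {f : ℝ → ℂ} {μ : Measure ℝ} (hf : Measurable f)
    (h : ∫⁻ t, ‖f t‖ₑ ^ 2 ∂μ ≠ ∞) : MemLp f 2 μ := by
  refine ⟨hf.aestronglyMeasurable, ?_⟩
  rw [eLpNorm_lt_top_iff_lintegral_rpow_enorm_lt_top (by simp) (by simp)]
  simpa using h.lt_top

lemma memLp_chirp_sub {a : ℂ} (ha : 0 < a.re) (l : ℝ) :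
    MemLp (fun t => (starRingEnd ℂ) (chirp a (l - t))) 2 volume := by
  refine memLp_two_of_lintegral ?_ ?_
  · exact Complex.continuous_conj.measurable.comp
      ((continuous_chirp a).measurable.comp (by fun_prop))
  · have h := lintegral_synth_le ha (Pi.single 0 1)
    have hs : synth a (Pi.single 0 1) = chirp a := by
      funext x
      rw [synth, tsum_eq_single 0 (fun n hn => by simp [hn])]
      simp
    have hc : sqSum (Pi.single 0 1 : ℤ → ℂ) ≠ ∞ :=
      sqSum_ne_top_of_finite ((Set.finite_singleton 0).subset (Pi.support_single_subset))
    rw [hs] at h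
    simp only [RCLike.enorm_conj]
    rw [lintegral_sub_left_eq_self (fun t => ‖chirp a t‖ₑ ^ 2) l]
    exact ne_top_of_le_ne_top (ENNReal.mul_ne_top (besselConst_ne_top a one_pos) hc) h

lemma gaborCoef_eq_fourierCoeffOn {a : ℂ} (ha : 0 < a.re) {f : ℝ → ℂ} (hf : Measurable f)
    (hfL : MemLp f 2 volume) (t₀ l : ℝ) (k : ℤ) :
    gaborCoef (chirp a) f (l, k) = fourierCoeffOn (lt_add_one t₀)
      (fun t => (starRingEnd ℂ) (synth a (fiber f t) (l - t))) (-k) := by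
  set e : ℝ → ℂ := fun t => Complex.exp (2 * Real.pi * Complex.I * k * t) with he
  have hec : Continuous e := by rw [he]; fun_prop
  have he1 : ∀ t, ‖e t‖ = 1 := fun t => by
    rw [he]; simp [Complex.norm_exp]
  have heper : ∀ (t : ℝ) (n : ℤ), e (t + n) = e t := fun t n => by
    rw [he]
    simp only
    rw [Complex.exp_eq_exp_iff_exists_int]
    exact ⟨k * n, by push_cast; ring⟩
  set F : ℝ → ℂ := fun t => f t * (starRingEnd ℂ) (chirp a (l - t)) * e t with hF
  have hFm : Measurable F := by
    refine (hf.mul (Complex.continuous_conj.measurable.comp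
      ((continuous_chirp a).measurable.comp (by fun_prop)))).mul hec.measurable
  have hFi : Integrable F := by
    have h1 : Integrable (fun t => f t * (starRingEnd ℂ) (chirp a (l - t))) :=
      hfL.integrable_mul (memLp_chirp_sub ha l)
    exact h1.mul_bdd (c := 1) hec.aestronglyMeasurable (Eventually.of_forall fun t => (he1 t).le)
  have hG : gaborCoef (chirp a) f (l, k) = ∫ t, F t := by
    rw [gaborCoef]
    refine integral_congr_ae (Eventually.of_forall fun t => ?_)
    simp only [hF, he, map_mul, ← Complex.exp_conj]
    simp only [map_neg, map_ofNat, conj_ofReal, conj_I]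
    push_cast
    ring_nf
  rw [hG, integral_eq_integral_Ioc_tsum hFi hFm t₀, fourierCoeffOn_eq_integral,
    intervalIntegral.integral_of_le (by linarith)]
  simp only [add_sub_cancel_left, div_one, one_smul]
  refine integral_congr_ae (Eventually.of_forall fun t => ?_)
  simp only [hF, heper, fourier_coe_apply, smul_eq_mul, synth, fiber]
  rw [tsum_mul_right, mul_comm, conj_tsum]
  congr 1
  · simp [he]
  · refine tsum_congr fun n => ?_
    simp [sub_sub]


lemma tsum_enorm_gaborCoef_sq {a : ℂ} (ha : 0 < a.re) {f : ℝ → ℂ} (hf : Measurable f)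
    (hfL : MemLp f 2 volume) (t₀ l : ℝ) :
    ∑' k : ℤ, ‖gaborCoef (chirp a) f (l, k)‖ₑ ^ 2 =
      ∫⁻ t in Set.Ioc t₀ (t₀ + 1), ‖synth a (fiber f t) (l - t)‖ₑ ^ 2 := by
  set P : ℝ → ℂ := fun t => (starRingEnd ℂ) (synth a (fiber f t) (l - t)) with hP
  have hPm : Measurable P :=
    Complex.continuous_conj.measurable.comp (measurable_synth_fiber a hf l)
  have hPe : ∀ t, ‖P t‖ₑ = ‖synth a (fiber f t) (l - t)‖ₑ := fun t => by simp [hP]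
  have hPL : MemLp P 2 (volume.restrict (Set.Ioc t₀ (t₀ + 1))) := by
    refine memLp_two_of_lintegral hPm ?_
    simp only [hPe]
    exact ne_top_of_le_ne_top (ENNReal.mul_ne_top (besselConst_ne_top a one_pos)
      (lintegral_enorm_sq_ne_top hfL)) (lintegral_synth_fiber_le ha hf l t₀)
  have hpars := hasSum_sq_fourierCoeffOn (lt_add_one t₀) hPL
  simp only [add_sub_cancel_left, inv_one, one_smul] at hpars
  have hsum : ∑' k : ℤ, ‖fourierCoeffOn (lt_add_one t₀) P k‖ₑ ^ 2 =
      ENNReal.ofReal (∫ x in t₀..t₀ + 1, ‖P x‖ ^ 2) := by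
    rw [← hpars.tsum_eq, ENNReal.ofReal_tsum_of_nonneg (fun _ => by positivity) hpars.summable]
    refine tsum_congr fun k => ?_
    rw [ENNReal.ofReal_pow (norm_nonneg _), ofReal_norm]
  simp only [gaborCoef_eq_fourierCoeffOn ha hf hfL t₀, ← hPe]
  refine ((Equiv.neg ℤ).tsum_eq (fun k => ‖fourierCoeffOn (lt_add_one t₀) P k‖ₑ ^ 2)).trans ?_
  rw [hsum, intervalIntegral.integral_of_le (by linarith),
    ofReal_integral_eq_lintegral_ofReal (hPL.integrable_norm_pow (by simp))
      (Eventually.of_forall fun _ => by positivity)]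
  refine lintegral_congr fun t => ?_
  rw [ENNReal.ofReal_pow (norm_nonneg _), ofReal_norm]

lemma SepFamily.countable {Λ : Set ℝ} {δ : ℝ} (hδ : 0 < δ)
    (hΛ : SepFamily δ (Subtype.val : Λ → ℝ)) : Countable Λ := by
  have hinj : Function.Injective fun l : Λ => ⌊(l : ℝ) / δ⌋ := by
    intro l m hlm
    by_contra hne
    have h1 := Int.abs_sub_lt_one_of_floor_eq_floor hlm
    have h2 := hΛ l m hne
    rw [← sub_div, abs_div, abs_of_pos hδ, div_lt_one hδ] at h1
    linarith
  exact hinj.countable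

/-- The time-frequency set `Λ × ℤ`. -/
def prodInt (Λ : Set ℝ) : Set (ℝ × ℝ) := {p | p.1 ∈ Λ ∧ ∃ k : ℤ, p.2 = (k : ℝ)}

/-- The set `Λ × ℤ` is parametrized by pairs. -/
def prodIntEquiv (Λ : Set ℝ) : Λ × ℤ ≃ prodInt Λ :=
  Equiv.ofBijective (fun q => ⟨(q.1, q.2), q.1.2, q.2, rfl⟩) <| by
    constructor
    · rintro ⟨⟨l, hl⟩, k⟩ ⟨⟨m, hm⟩, j⟩ h
      have h' := congrArg Subtype.val h
      simpa using h'
    · rintro ⟨⟨l, y⟩, hl, k, hk⟩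
      simp only at hl hk
      subst hk
      exact ⟨(⟨l, hl⟩, k), rfl⟩

lemma tsum_gaborCoef_sq {a : ℂ} (ha : 0 < a.re) {Λ : Set ℝ} {δ : ℝ} (hδ : 0 < δ)
    (hΛ : SepFamily δ (Subtype.val : Λ → ℝ)) {f : ℝ → ℂ} (hf : Measurable f)
    (hfL : MemLp f 2 volume) (t₀ : ℝ) :
    ∑' p : prodInt Λ, ‖gaborCoef (chirp a) f p‖ ^ 2 =
      (∫⁻ t in Set.Ioc t₀ (t₀ + 1), sqSum fun l : Λ => synth a (fiber f t) (l - t)).toReal := by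
  have := SepFamily.countable hδ hΛ
  rw [← (prodIntEquiv Λ).tsum_eq, ← toReal_sqSum (fun q => gaborCoef (chirp a) f (prodIntEquiv Λ q))]
  unfold sqSum
  rw [lintegral_tsum fun l : Λ =>
    ((measurable_synth_fiber a hf (l : ℝ)).enorm.pow_const 2).aemeasurable, ENNReal.tsum_prod']
  simp only [← tsum_enorm_gaborCoef_sq ha hf hfL t₀]
  rfl

lemma isGaborFrame_of_lower_bound {a : ℂ} (ha : 0 < a.re) {Λ : Set ℝ} {δ : ℝ} (hδ : 0 < δ)
    (hΛ : SepFamily δ (Subtype.val : Λ → ℝ)) {A : ℝ≥0∞} (hA : A ≠ ∞)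
    (h : ∀ (x : ℝ) (c : ℤ → ℂ), sqSum c ≠ ∞ →
      sqSum c ≤ A * sqSum (fun l : Λ => synth a c (l + x))) :
    IsGaborFrame (chirp a) (prodInt Λ) := by
  have hB := besselConst_ne_top a hδ
  refine ⟨(A.toReal + 1)⁻¹, (besselConst a δ).toReal + 1, by positivity, by positivity, ?_⟩
  suffices key : ∀ f : ℝ → ℂ, Measurable f → MemLp f 2 volume →
      (A.toReal + 1)⁻¹ * (∫ t : ℝ, ‖f t‖ ^ 2) ≤
        (∑' p : prodInt Λ, ‖gaborCoef (chirp a) f p‖ ^ 2) ∧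
      (∑' p : prodInt Λ, ‖gaborCoef (chirp a) f p‖ ^ 2) ≤
        ((besselConst a δ).toReal + 1) * (∫ t : ℝ, ‖f t‖ ^ 2) by
    intro f hf
    have hae := hf.1.ae_eq_mk
    have h1 : ∫ t : ℝ, ‖f t‖ ^ 2 = ∫ t : ℝ, ‖hf.1.mk f t‖ ^ 2 :=
      integral_congr_ae (hae.mono fun t ht => by simp only [ht])
    have h2 : ∀ p, gaborCoef (chirp a) f p = gaborCoef (chirp a) (hf.1.mk f) p := fun p =>
      integral_congr_ae (hae.mono fun t ht => by simp only [ht])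
    simp only [h1, h2]
    exact key _ hf.1.stronglyMeasurable_mk.measurable (hf.ae_eq hae)
  intro f hf hfL
  have hfin := lintegral_enorm_sq_ne_top hfL
  have hup : ∫⁻ t in Set.Ioc (0 : ℝ) (0 + 1), sqSum (fun l : Λ => synth a (fiber f t) (l - t)) ≤
      besselConst a δ * ∫⁻ t, ‖f t‖ₑ ^ 2 := by
    rw [← lintegral_sqSum_fiber hf 0, ← lintegral_const_mul' _ _ hB]
    exact lintegral_mono fun t => sqSum_synth_le ha hδ (hΛ.add_const (-t)) _
  have hlow : ∫⁻ t, ‖f t‖ₑ ^ 2 ≤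
      A * ∫⁻ t in Set.Ioc (0 : ℝ) (0 + 1), sqSum fun l : Λ => synth a (fiber f t) (l - t) := by
    have hm : Measurable fun t => sqSum (fiber f t) := by
      unfold sqSum fiber
      exact Measurable.tsum fun n => ((Complex.continuous_conj.measurable.comp
        (hf.comp (measurable_add_const _))).enorm.pow_const 2)
    rw [← lintegral_sqSum_fiber hf 0, ← lintegral_const_mul' _ _ hA]
    rw [← lintegral_sqSum_fiber hf 0] at hfin
    refine lintegral_mono_ae ((ae_lt_top hm hfin).mono fun t ht => ?_)
    exact h (-t) _ ht.ne
  rw [tsum_gaborCoef_sq ha hδ hΛ hf hfL 0, ← toReal_lintegral_enorm_sq hfL.1]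
  exact ⟨inv_mul_toReal_le_of_le_mul hA
    (ne_top_of_le_ne_top (ENNReal.mul_ne_top hB hfin) hup) hlow,
    toReal_le_of_le_mul hB hfin hup⟩


/-- The step function with values `conj (c n)` on `(t₀ + n, t₀ + n + r]`. -/
def stepFun (c : ℤ → ℂ) (t₀ r : ℝ) (t : ℝ) : ℂ :=
  if t - t₀ - (⌈t - t₀⌉ - 1 : ℤ) ≤ r then (starRingEnd ℂ) (c (⌈t - t₀⌉ - 1)) else 0

lemma measurable_stepFun (c : ℤ → ℂ) (t₀ r : ℝ) : Measurable (stepFun c t₀ r) := by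
  have hn : Measurable fun t : ℝ => ⌈t - t₀⌉ - 1 :=
    (measurable_of_countable fun n : ℤ => n - 1).comp
      (Int.measurable_ceil.comp (measurable_sub_const t₀))
  refine Measurable.ite (measurableSet_le ?_ measurable_const) ?_ measurable_const
  · exact (measurable_sub_const t₀).sub ((measurable_of_countable fun n : ℤ => (n : ℝ)).comp hn)
  · exact (measurable_of_countable fun n : ℤ => (starRingEnd ℂ) (c n)).comp hn

lemma fiber_stepFun (c : ℤ → ℂ) {t₀ r t : ℝ} (ht : t ∈ Set.Ioc t₀ (t₀ + 1)) :
    fiber (stepFun c t₀ r) t = if t ≤ t₀ + r then c else 0 := by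
  have hceil : ⌈t - t₀⌉ = 1 := by
    rw [Int.ceil_eq_iff]
    constructor
    · norm_num; exact ht.1
    · norm_num; linarith [ht.2]
  funext n
  have hn : ⌈t + n - t₀⌉ - 1 = n := by
    rw [show t + n - t₀ = t - t₀ + n by ring, Int.ceil_add_intCast, hceil]
    ring
  simp only [fiber, stepFun, hn]
  have : t + n - t₀ - n ≤ r ↔ t ≤ t₀ + r := by constructor <;> intro h <;> linarith
  simp only [this]
  split_ifs <;> simp

lemma setLIntegral_Ioc_ite {t₀ r : ℝ} (hr : r ≤ 1) (K : ℝ≥0∞) :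
    ∫⁻ t in Set.Ioc t₀ (t₀ + 1), (if t ≤ t₀ + r then K else 0) = K * ENNReal.ofReal r := by
  have : (fun t : ℝ => if t ≤ t₀ + r then K else 0) = (Set.Iic (t₀ + r)).indicator fun _ => K := by
    funext t; simp [Set.indicator]
  rw [this, lintegral_indicator_const measurableSet_Iic, Measure.restrict_apply measurableSet_Iic,
    Set.inter_comm, Set.Ioc_inter_Iic, min_eq_right (by linarith), Real.volume_Ioc,
    add_sub_cancel_left]

lemma exists_uniformLower_of_isGaborFrame {a : ℂ} (ha : 0 < a.re) {Λ : Set ℝ} {δ : ℝ}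
    (hδ : 0 < δ) (hΛ : SepFamily δ (Subtype.val : Λ → ℝ))
    (h : IsGaborFrame (chirp a) (prodInt Λ)) :
    ∃ A : ℝ≥0∞, A ≠ ∞ ∧ UniformLower a A (Subtype.val : Λ → ℝ) := by
  obtain ⟨A, B, hA, -, hAB⟩ := h
  obtain ⟨r, hr0, hr1, hr⟩ := exists_sqSum_synth_perturb ha hδ (ε := ENNReal.ofReal (A / 2))
    (by simpa using hA)
  refine ⟨2 * (2 * ENNReal.ofReal A⁻¹), by simp [ENNReal.mul_eq_top], fun x c hc => ?_⟩
  have hS := sqSum_ne_top_of_finite hc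
  set S := sqSum c with hSdef
  set Y := sqSum (fun l : Λ => synth a c (l + x)) with hY
  set f := stepFun c (-x) r with hf
  have hfm : Measurable f := measurable_stepFun c (-x) r
  have hnorm : ∫⁻ t, ‖f t‖ₑ ^ 2 = S * ENNReal.ofReal r := by
    rw [← lintegral_sqSum_fiber hfm (-x), ← setLIntegral_Ioc_ite (t₀ := -x) hr1]
    refine setLIntegral_congr_fun measurableSet_Ioc fun t ht => ?_
    simp only [hf, fiber_stepFun c ht]
    split_ifs <;> simp [sqSum, hSdef]
  have hfL : MemLp f 2 volume := memLp_two_of_lintegral hfm (by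
    rw [hnorm]; exact ENNReal.mul_ne_top hS ENNReal.ofReal_ne_top)
  have hcoef : ∫⁻ t in Set.Ioc (-x) (-x + 1), sqSum (fun l : Λ => synth a (fiber f t) (l - t)) ≤
      (2 * Y + ENNReal.ofReal (A / 2) * S) * ENNReal.ofReal r := by
    rw [← setLIntegral_Ioc_ite (t₀ := -x) hr1]
    refine setLIntegral_mono' measurableSet_Ioc fun t ht => ?_
    simp only [hf, fiber_stepFun c ht]
    split_ifs with htr
    · have := hr Λ Subtype.val hΛ (-t) x (by
        rw [abs_le]; constructor <;> linarith [ht.1]) c hS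
      simpa only [sub_eq_add_neg] using this
    · simp [sqSum, synth]
  have hmain := (hAB f hfL).1
  rw [tsum_gaborCoef_sq ha hδ hΛ hfm hfL (-x), ← toReal_lintegral_enorm_sq hfL.1, hnorm] at hmain
  have hmain' : ENNReal.ofReal A * S * ENNReal.ofReal r ≤
      (2 * Y + ENNReal.ofReal (A / 2) * S) * ENNReal.ofReal r := by
    refine le_trans ?_ hcoef
    rw [mul_assoc, ← ENNReal.ofReal_toReal (ENNReal.mul_ne_top hS (ENNReal.ofReal_ne_top (r := r))),
      ← ENNReal.ofReal_mul hA.le]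
    exact (ENNReal.ofReal_le_ofReal hmain).trans ENNReal.ofReal_toReal_le
  rw [ENNReal.mul_le_mul_iff_left (by simpa using hr0) ENNReal.ofReal_ne_top] at hmain'
  rw [mul_assoc]
  refine le_two_mul_of_le_half_add hS ?_
  calc S = ENNReal.ofReal A⁻¹ * (ENNReal.ofReal A * S) := by
        rw [← mul_assoc, ← ENNReal.ofReal_mul (by positivity), inv_mul_cancel₀ hA.ne']
        simp
    _ ≤ ENNReal.ofReal A⁻¹ * (2 * Y + ENNReal.ofReal (A / 2) * S) := by gcongr
    _ = (ENNReal.ofReal A⁻¹ * ENNReal.ofReal (A / 2)) * S + 2 * ENNReal.ofReal A⁻¹ * Y := by ring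
    _ = _ := by
        rw [← ENNReal.ofReal_mul (by positivity), show A⁻¹ * (A / 2) = 1 / 2 by field_simp,
          ENNReal.ofReal_div_of_pos (by norm_num)]
        simp

lemma eventually_ofReal_sq_mul_le_half {β : Type} {l : Filter β} {u : β → ℝ}
    (hu : Tendsto u l (nhds 0)) {K : ℝ≥0∞} (hK : K ≠ ∞) :
    ∀ᶠ x in l, ENNReal.ofReal (u x) ^ 2 * K ≤ 1 / 2 := by
  have h := ENNReal.Tendsto.mul_const
    (((ENNReal.continuous_pow 2).tendsto _).comp (ENNReal.tendsto_ofReal hu)) (Or.inr hK)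
  refine Tendsto.eventually_le_const (v := 0) (by simp) ?_
  simpa using h

lemma exists_kernel_vector {ι : Type} {I : Set ι} (hI : I.Finite) (J : Finset ℤ)
    (hcard : I.ncard < J.card) (k : ι → ℤ → ℂ) :
    ∃ c : ℤ → ℂ, c ≠ 0 ∧ (∀ n ∉ J, c n = 0) ∧ ∀ i ∈ I, ∑ n ∈ J, c n * k i n = 0 := by
  have := hI.to_subtype
  have := Fintype.ofFinite I
  let φ : (J → ℂ) →ₗ[ℂ] (I → ℂ) := Matrix.toLin' (Matrix.of fun (i : I) (n : J) => k i n)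
  have hker : LinearMap.ker φ ≠ ⊥ := by
    apply LinearMap.ker_ne_bot_of_finrank_lt
    rw [Module.finrank_fintype_fun_eq_card, Module.finrank_fintype_fun_eq_card, Fintype.card_coe,
      ← Nat.card_eq_fintype_card]
    exact hcard
  obtain ⟨d, hd, hd0⟩ := (Submodule.ne_bot_iff _).mp hker
  refine ⟨fun n => if h : n ∈ J then d ⟨n, h⟩ else 0, fun h0 => hd0 ?_, fun n hn => by simp [hn], ?_⟩
  · funext n
    have := congrFun h0 n
    simpa using this
  · intro i hi
    have := congrFun (LinearMap.mem_ker.mp hd) ⟨i, hi⟩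
    rw [← Finset.sum_coe_sort]
    simpa [φ, Matrix.mulVec, dotProduct, mul_comm] using this

lemma exists_le_ncard_of_lower_bound {a : ℂ} (ha : 0 < a.re) {ι : Type} {δ : ℝ} (hδ : 0 < δ)
    {γ : ι → ℝ} (hγ : SepFamily δ γ) {A : ℝ≥0∞} (hA : A ≠ ∞)
    (h : ∀ c : ℤ → ℂ, c.support.Finite → sqSum c ≤ A * sqSum (fun i => synth a c (γ i))) :
    ∃ K : ℝ, ∀ u v : ℝ, {i | γ i ∈ Set.Icc u v}.Finite →
      v - u - K ≤ ({i | γ i ∈ Set.Icc u v}.ncard : ℝ) := by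
  set C := Real.exp (2 ^ 2 / (4 * a.re)) with hC
  have hlim : Tendsto (fun T : ℝ => C * Real.exp (-T)) atTop (nhds 0) := by
    simpa using Real.tendsto_exp_neg_atTop_nhds_zero.const_mul C
  obtain ⟨T, hT, hT0⟩ := ((eventually_ofReal_sq_mul_le_half hlim
    (K := A * (sepConst 1 * sepConst δ)) (ENNReal.mul_ne_top hA
      (ENNReal.mul_ne_top (sepConst_ne_top one_pos) (sepConst_ne_top hδ)))).and
    (eventually_ge_atTop 0)).exists
  refine ⟨2 * T + 1, fun u v hfin => ?_⟩
  set I := {i | γ i ∈ Set.Icc u v} with hI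
  set J := Finset.Icc ⌈u + T⌉ ⌊v - T⌋ with hJ
  suffices hcard : J.card ≤ I.ncard by
    have h1 : v - u - (2 * T + 1) ≤ (J.card : ℝ) := by
      have h2 : ⌊v - T⌋ + 1 - ⌈u + T⌉ ≤ (J.card : ℤ) := by
        rw [hJ, Int.card_Icc]; exact Int.self_le_toNat _
      have h3 : ((⌊v - T⌋ + 1 - ⌈u + T⌉ : ℤ) : ℝ) ≤ (J.card : ℝ) := by exact_mod_cast h2
      push_cast at h3
      have := Int.sub_one_lt_floor (v - T)
      have := Int.ceil_lt_add_one (u + T)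
      linarith
    exact h1.trans (by exact_mod_cast hcard)
  by_contra! hlt
  obtain ⟨c, hc0, hcJ, hcI⟩ := exists_kernel_vector hfin J hlt fun i n => chirp a (γ i - n)
  have hsupp : c.support.Finite := J.finite_toSet.subset fun n hn => by
    by_contra hnJ
    exact hn (hcJ n hnJ)
  have hzero : ∀ i ∈ I, synth a c (γ i) = 0 := fun i hi => by
    rw [synth, tsum_eq_sum (s := J) fun n hn => by simp [hcJ n hn]]
    exact hcI i hi
  have hbound : sqSum (fun i => synth a c (γ i)) ≤
      ENNReal.ofReal (C * Real.exp (-T)) ^ 2 * (sepConst 1 * sepConst δ) * sqSum c := by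
    refine tsum_enorm_sq_le_of_kernel hδ hγ (b := fun n => ‖c n‖ₑ) fun i => ?_
    by_cases hi : i ∈ I
    · simp [hzero i hi]
    refine enorm_tsum_le_tsum_enorm.trans (ENNReal.tsum_le_tsum fun n => ?_)
    by_cases hn : n ∈ J
    · rw [enorm_mul, mul_comm]
      refine mul_le_mul_left ?_ _
      rw [expDecay, ← ENNReal.ofReal_mul (by positivity)]
      refine enorm_le_ofReal ((norm_chirp_le ha 2 _).trans ?_)
      rw [mul_assoc, ← Real.exp_add (-T)]
      refine mul_le_mul_of_nonneg_left (Real.exp_le_exp.mpr ?_) (Real.exp_pos _).le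
      have hTn : T ≤ |γ i - n| := by
        rw [hJ, Finset.mem_Icc] at hn
        have h1 := Int.ceil_le.mp hn.1
        have h2 := Int.le_floor.mp hn.2
        rw [le_abs']
        by_contra! hcon
        exact hi ⟨by linarith, by linarith⟩
      linarith
    · simp [hcJ n hn]
  have hS := sqSum_ne_top_of_finite hsupp
  have hS0 : sqSum c ≤ 2 * 0 := by
    refine le_two_mul_of_le_half_add hS ?_
    calc sqSum c ≤ A * (ENNReal.ofReal (C * Real.exp (-T)) ^ 2 * (sepConst 1 * sepConst δ) *
          sqSum c) := (h c hsupp).trans (mul_le_mul_right hbound A)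
      _ = ENNReal.ofReal (C * Real.exp (-T)) ^ 2 * (A * (sepConst 1 * sepConst δ)) * sqSum c := by
          ring
      _ ≤ 1 / 2 * sqSum c + 0 := by rw [add_zero]; gcongr
  apply hc0
  funext n
  have : sqSum c = 0 := by simpa using hS0
  rw [sqSum, ENNReal.tsum_eq_zero] at this
  simpa using this n

/-- The tent function of height one supported in `[-L, L]`. -/
def tent (L t : ℝ) : ℝ := max 0 (1 - |t| / L)

lemma tent_nonneg (L t : ℝ) : 0 ≤ tent L t := le_max_left _ _

lemma tent_le_one {L : ℝ} (hL : 0 < L) (t : ℝ) : tent L t ≤ 1 :=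
  max_le zero_le_one (by linarith [div_nonneg (abs_nonneg t) hL.le])

lemma tent_eq_zero {L t : ℝ} (hL : 0 < L) (h : L ≤ |t|) : tent L t = 0 := by
  have := (one_le_div hL).mpr h
  exact max_eq_left (by linarith)

lemma half_le_tent {L t : ℝ} (hL : 0 < L) (h : |t| ≤ L / 2) : 1 / 2 ≤ tent L t := by
  refine le_max_of_le_right ?_
  have : |t| / L ≤ 1 / 2 := by rw [div_le_iff₀ hL]; linarith
  linarith

lemma abs_tent_sub_le {L : ℝ} (hL : 0 < L) (s t : ℝ) : |tent L s - tent L t| ≤ |s - t| / L := by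
  refine (abs_max_sub_max_le_max _ _ _ _).trans ?_
  rw [sub_self, abs_zero, max_eq_right (abs_nonneg _),
    show 1 - |s| / L - (1 - |t| / L) = (|t| - |s|) / L by ring, abs_div, abs_of_pos hL]
  refine div_le_div_of_nonneg_right ?_ hL.le
  rw [abs_sub_comm s t]
  exact abs_abs_sub_abs_le _ _

/-- A constant controlling the localization error of `tent`. -/
def tentConst (a : ℂ) : ℝ := Real.exp (3 ^ 2 / (4 * a.re)) + chirpLip a

lemma tentConst_nonneg (a : ℂ) : 0 ≤ tentConst a :=
  add_nonneg (Real.exp_pos _).le (chirpLip_nonneg a)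

lemma norm_tent_mul_chirp_sub_le {a : ℂ} (ha : 0 < a.re) {L : ℝ} (hL : 1 ≤ L) {y μ : ℝ} {j : ℝ}
    (hμ : μ - y = (y - j) / L ^ 2) (n : ℝ) :
    ‖(tent L (n - j) : ℂ) * chirp a (y - n) - tent L (y - j) * chirp a (μ - n)‖ ≤
      tentConst a / L * Real.exp (-|y - n|) * min 1 (Real.exp (L - |n - j|)) := by
  have hL0 : 0 < L := by linarith
  have hC := tentConst_nonneg a
  by_cases hfar : L ≤ |n - j| ∧ L ≤ |y - j|
  · rw [tent_eq_zero hL0 hfar.1, tent_eq_zero hL0 hfar.2]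
    simp only [ofReal_zero, zero_mul, sub_zero, norm_zero]
    positivity
  have hnj : |n - j| ≤ L + |y - n| := by
    rw [not_and_or, not_le, not_le] at hfar
    rcases hfar with h | h
    · linarith [abs_nonneg (y - n)]
    · have := abs_sub_le n y j
      rw [abs_sub_comm n y] at this
      linarith
  have hmin : Real.exp (-(2 * |y - n|)) ≤
      Real.exp (-|y - n|) * min 1 (Real.exp (L - |n - j|)) := by
    rw [mul_min_of_nonneg _ _ (Real.exp_pos _).le, mul_one, ← Real.exp_add]
    refine le_min ?_ ?_ <;> refine Real.exp_le_exp.mpr ?_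
    · linarith [abs_nonneg (y - n)]
    · linarith
  have hfirst : ‖((tent L (n - j) - tent L (y - j) : ℝ) : ℂ) * chirp a (y - n)‖ ≤
      Real.exp (3 ^ 2 / (4 * a.re)) / L * Real.exp (-(2 * |y - n|)) := by
    rw [norm_mul, norm_real, Real.norm_eq_abs]
    have h1 := abs_tent_sub_le hL0 (n - j) (y - j)
    rw [show n - j - (y - j) = -(y - n) by ring, abs_neg] at h1
    have h2 := norm_chirp_le ha 3 (y - n)
    have h3 : |y - n| ≤ Real.exp |y - n| := (by linarith : |y - n| ≤ |y - n| + 1).trans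
      (Real.add_one_le_exp _)
    calc _ ≤ Real.exp |y - n| / L *
          (Real.exp (3 ^ 2 / (4 * a.re)) * Real.exp (-(3 * |y - n|))) := by
          gcongr
          exact h1.trans (by gcongr)
      _ = Real.exp (3 ^ 2 / (4 * a.re)) / L * (Real.exp |y - n| * Real.exp (-(3 * |y - n|))) := by
          ring
      _ = _ := by rw [← Real.exp_add]; ring_nf
  have hsecond : ‖(tent L (y - j) : ℂ) * (chirp a (y - n) - chirp a (μ - n))‖ ≤
      chirpLip a / L * Real.exp (-(2 * |y - n|)) := by
    rcases le_or_gt L |y - j| with h | h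
    · rw [tent_eq_zero hL0 h]
      have := chirpLip_nonneg a
      simp only [ofReal_zero, zero_mul, norm_zero]
      positivity
    have hd : |μ - n - (y - n)| ≤ 1 / L := by
      rw [show μ - n - (y - n) = μ - y by ring, hμ, abs_div, abs_of_pos (by positivity : 0 < L ^ 2),
        div_le_div_iff₀ (by positivity) hL0]
      nlinarith
    have hd1 : |μ - n - (y - n)| ≤ 1 := hd.trans ((div_le_one hL0).mpr hL)
    rw [norm_mul, norm_real, Real.norm_eq_abs, abs_of_nonneg (tent_nonneg _ _), norm_sub_rev]
    calc _ ≤ 1 * (chirpLip a * |μ - n - (y - n)| * Real.exp (-(2 * |y - n|))) := by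
          gcongr
          · exact tent_le_one hL0 _
          · exact norm_chirp_sub_le ha hd1
      _ ≤ chirpLip a * (1 / L) * Real.exp (-(2 * |y - n|)) := by
          rw [one_mul]
          have := chirpLip_nonneg a
          gcongr
      _ = _ := by ring
  calc _ = ‖((tent L (n - j) - tent L (y - j) : ℝ) : ℂ) * chirp a (y - n) +
        (tent L (y - j) : ℂ) * (chirp a (y - n) - chirp a (μ - n))‖ := by
        congr 1; push_cast; ring
    _ ≤ tentConst a / L * Real.exp (-(2 * |y - n|)) := by
        refine (norm_add_le _ _).trans ((add_le_add hfirst hsecond).trans_eq ?_)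
        rw [tentConst]; ring
    _ ≤ _ := by
        rw [mul_assoc]
        gcongr

/-- The weight `min 1 (exp (L - |t|))` in the extended nonnegative reals. -/
def tailWeight (L t : ℝ) : ℝ≥0∞ := ENNReal.ofReal (min 1 (Real.exp (L - |t|)))

lemma tailWeight_le_one (L t : ℝ) : tailWeight L t ≤ 1 := by
  rw [tailWeight, ENNReal.ofReal_le_one]
  exact min_le_left _ _

lemma tsum_tailWeight_le {L : ℕ} (hL : 1 ≤ L) (n : ℤ) :
    ∑' j : ℤ, tailWeight L (n - j) ≤ L * (3 + 2 * sepConst 1) := by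
  set J := Finset.Icc (n - (L : ℤ)) (n + L) with hJ
  have hcard : J.card = 2 * L + 1 := by rw [hJ, Int.card_Icc]; omega
  have hpt : ∀ j : ℤ, tailWeight L (n - j) ≤ (if j ∈ J then 1 else 0) +
      (expDecay ((n + L : ℝ) - j) + expDecay ((n - L : ℝ) - j)) := by
    intro j
    by_cases hj : j ∈ J
    · rw [if_pos hj]
      exact (tailWeight_le_one _ _).trans le_self_add
    rw [if_neg hj, zero_add]
    rw [hJ, Finset.mem_Icc, not_and_or, not_le, not_le] at hj
    rcases hj with hj | hj
    · have hj' : (j : ℝ) < n - L := by exact_mod_cast hj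
      refine le_trans ?_ le_add_self
      refine ENNReal.ofReal_le_ofReal ((min_le_right _ _).trans (Real.exp_le_exp.mpr ?_))
      have hL0 : (0 : ℝ) ≤ L := by positivity
      rw [abs_of_pos (by linarith), abs_of_pos (by linarith)]
      linarith
    · have hj' : (n : ℝ) + L < j := by exact_mod_cast hj
      refine le_trans ?_ le_self_add
      refine ENNReal.ofReal_le_ofReal ((min_le_right _ _).trans (Real.exp_le_exp.mpr ?_))
      have hL0 : (0 : ℝ) ≤ L := by positivity
      rw [abs_of_neg (by linarith), abs_of_neg (by linarith)]
      linarith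
  refine (ENNReal.tsum_le_tsum hpt).trans ?_
  rw [ENNReal.tsum_add, ENNReal.tsum_add, tsum_eq_sum (s := J) (fun j hj => if_neg hj),
    Finset.sum_congr rfl (fun j hj => if_pos hj), Finset.sum_const, hcard]
  have hL1 : (1 : ℝ≥0∞) ≤ L := by exact_mod_cast hL
  calc _ ≤ (2 * L + 1 : ℝ≥0∞) + (sepConst 1 + sepConst 1) := by
        refine add_le_add (by simp) (add_le_add ?_ ?_) <;> exact tsum_expDecay_int_le _
    _ ≤ (2 * L + L : ℝ≥0∞) + L * (2 * sepConst 1) := by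
        gcongr
        rw [← two_mul]
        exact le_mul_of_one_le_left' hL1
    _ = _ := by ring

lemma le_tsum_tent_sq {M : ℕ} (hM : 1 ≤ M) (n : ℤ) :
    ((2 * M : ℕ) : ℝ≥0∞) * 4⁻¹ ≤ ∑' j : ℤ, ENNReal.ofReal (tent (2 * M : ℕ) (n - j)) ^ 2 := by
  set J := Finset.Icc (n - (M : ℤ)) (n + M) with hJ
  have hcard : J.card = 2 * M + 1 := by rw [hJ, Int.card_Icc]; omega
  have hterm : ∀ j ∈ J, (4⁻¹ : ℝ≥0∞) ≤ ENNReal.ofReal (tent (2 * M : ℕ) (n - j)) ^ 2 := by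
    intro j hj
    rw [hJ, Finset.mem_Icc] at hj
    have h1 : (n : ℝ) - M ≤ j := by exact_mod_cast hj.1
    have h2 : (j : ℝ) ≤ n + M := by exact_mod_cast hj.2
    have h3 := half_le_tent (L := (2 * M : ℕ)) (t := (n : ℝ) - j)
      (by exact_mod_cast (by omega : 0 < 2 * M)) (by
        push_cast
        rw [abs_le]; constructor <;> linarith)
    calc (4⁻¹ : ℝ≥0∞) = ENNReal.ofReal (1 / 2) ^ 2 := by
          rw [← ENNReal.ofReal_pow (by norm_num), ← ENNReal.ofReal_ofNat,
            ← ENNReal.ofReal_inv_of_pos (by norm_num)]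
          norm_num
      _ ≤ _ := by gcongr
  calc _ ≤ ((2 * M + 1 : ℕ) : ℝ≥0∞) * 4⁻¹ := by gcongr; omega
    _ = ∑ j ∈ J, (4⁻¹ : ℝ≥0∞) := by rw [Finset.sum_const, hcard, nsmul_eq_mul]
    _ ≤ ∑ j ∈ J, ENNReal.ofReal (tent (2 * M : ℕ) (n - j)) ^ 2 := Finset.sum_le_sum hterm
    _ ≤ _ := ENNReal.sum_le_tsum _

lemma tsum_tent_sq_le {L : ℕ} (hL : 1 ≤ L) {τ : ℝ} (hτ : 0 ≤ τ) (hτ1 : τ ≤ 1) (μ : ℝ) :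
    ∑' j : ℤ, ENNReal.ofReal (tent L ((μ - j) / (1 + τ))) ^ 2 ≤ L * 5 := by
  set J := Finset.Icc ⌈μ - 2 * L⌉ ⌊μ + 2 * L⌋ with hJ
  have hL1 : (1 : ℝ) ≤ L := by exact_mod_cast hL
  have hcard : (J.card : ℝ) ≤ L * 5 := by
    have h1 : (J.card : ℝ) = ((⌊μ + 2 * L⌋ + 1 - ⌈μ - 2 * L⌉ : ℤ) : ℝ) := by
      rw [hJ, Int.card_Icc, ← Int.cast_natCast, Int.toNat_of_nonneg]
      have : ⌈μ - 2 * L⌉ ≤ ⌊μ + 2 * L⌋ + 1 := by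
        rw [Int.ceil_le]
        push_cast
        linarith [Int.lt_floor_add_one (μ + 2 * L)]
      omega
    rw [h1]
    push_cast
    linarith [Int.floor_le (μ + 2 * L), Int.le_ceil (μ - 2 * L)]
  rw [tsum_eq_sum (s := J)]
  · calc _ ≤ ∑ j ∈ J, (1 : ℝ≥0∞) := by
          refine Finset.sum_le_sum fun j _ => pow_le_one' ?_ 2
          rw [ENNReal.ofReal_le_one]
          exact tent_le_one (by linarith) _
      _ ≤ _ := by
          rw [Finset.sum_const, nsmul_eq_mul, mul_one]
          exact_mod_cast hcard
  · intro j hj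
    rw [tent_eq_zero (by linarith)]
    · simp
    rw [abs_div, abs_of_pos (by linarith : 0 < 1 + τ), le_div_iff₀ (by linarith)]
    by_contra! hlt
    apply hj
    have h2 : |μ - j| < 2 * L := hlt.trans_le (by nlinarith)
    rw [abs_lt] at h2
    rw [hJ, Finset.mem_Icc, Int.ceil_le, Int.le_floor]
    constructor <;> linarith

lemma enorm_tent (L t : ℝ) : ‖(tent L t : ℂ)‖ₑ = ENNReal.ofReal (tent L t) := by
  rw [← ofReal_norm, norm_real, Real.norm_of_nonneg (tent_nonneg _ _)]

lemma sqSum_tent_sub_le {a : ℂ} (ha : 0 < a.re) {ι : Type} {δ : ℝ} (hδ : 0 < δ) {y μ : ι → ℝ}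
    (hy : SepFamily δ y) {L : ℝ} (hL : 1 ≤ L) {j : ℝ} (hμ : ∀ i, μ i - y i = (y i - j) / L ^ 2)
    {c : ℤ → ℂ} (hc : c.support.Finite) :
    sqSum (fun i => synth a (fun n => tent L (n - j) * c n) (y i) -
        tent L (y i - j) * synth a c (μ i)) ≤
      ENNReal.ofReal (tentConst a / L) ^ 2 * (sepConst 1 * sepConst δ) *
        ∑' n : ℤ, tailWeight L (n - j) * ‖c n‖ₑ ^ 2 := by
  have hC := tentConst_nonneg a
  have hcj : (fun n : ℤ => (tent L (n - j) : ℂ) * c n).support.Finite :=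
    hc.subset fun n hn hn0 => hn (by simp [hn0])
  have h := tsum_enorm_sq_le_of_kernel (u := fun i =>
      synth a (fun n => tent L (n - j) * c n) (y i) - tent L (y i - j) * synth a c (μ i))
    (b := fun n : ℤ => tailWeight L (n - j) * ‖c n‖ₑ) (η := ENNReal.ofReal (tentConst a / L))
    hδ hy fun i => ?_
  · refine h.trans (mul_le_mul_right (ENNReal.tsum_le_tsum fun n => ?_) _)
    rw [mul_pow]
    gcongr
    exact (pow_le_pow_right_of_le_one' (tailWeight_le_one _ _) one_le_two).trans_eq (pow_one _)
  · rw [synth, synth, ← tsum_mul_left,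
      ← (summable_synth ha (sqSum_ne_top_of_finite hcj) _).tsum_sub
        ((summable_synth ha (sqSum_ne_top_of_finite hc) _).mul_left _)]
    refine enorm_tsum_le_tsum_enorm.trans (ENNReal.tsum_le_tsum fun n => ?_)
    have hfac : (tent L (n - j) : ℂ) * c n * chirp a (y i - n) -
        tent L (y i - j) * (c n * chirp a (μ i - n)) =
        ((tent L (n - j) : ℂ) * chirp a (y i - n) - tent L (y i - j) * chirp a (μ i - n)) *
          c n := by ring
    rw [hfac, enorm_mul, ← mul_assoc]
    gcongr
    rw [tailWeight, expDecay, ← ENNReal.ofReal_mul (by positivity),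
      ← ENNReal.ofReal_mul (by positivity)]
    exact enorm_le_ofReal (norm_tent_mul_chirp_sub_le ha hL (hμ i) n)

/-- A uniform lower bound for all translates survives a slight dilation of the points. -/
lemma exists_lower_bound_dilate {a : ℂ} (ha : 0 < a.re) {ι : Type} {δ : ℝ} (hδ : 0 < δ)
    {γ : ι → ℝ} (hγ : SepFamily δ γ) {A : ℝ≥0∞} (hA : A ≠ ∞) (h : UniformLower a A γ) :
    ∃ τ : ℝ, 0 < τ ∧ ∀ c : ℤ → ℂ, c.support.Finite →
      sqSum c ≤ 2 * (40 * A) * sqSum (fun i => synth a c ((1 + τ) * γ i)) := by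
  set k := sepConst 1 * sepConst δ with hk
  set K := 3 + 2 * sepConst 1 with hK
  have hk' : k ≠ ∞ := ENNReal.mul_ne_top (sepConst_ne_top one_pos) (sepConst_ne_top hδ)
  have hK' : K ≠ ∞ := by simp [hK, ENNReal.mul_eq_top, sepConst_ne_top one_pos]
  have hlim : Tendsto (fun M : ℕ => tentConst a / (2 * M : ℕ)) atTop (nhds 0) := by
    refine Tendsto.div_atTop tendsto_const_nhds ?_
    exact tendsto_natCast_atTop_atTop.comp
      (tendsto_id.const_mul_atTop' (by norm_num : 0 < 2))
  obtain ⟨M, hη, hM⟩ := ((eventually_ofReal_sq_mul_le_half hlim (K := 8 * A * k * K)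
    (by simp [ENNReal.mul_eq_top, hA, hk', hK'])).and (eventually_ge_atTop 1)).exists
  set L : ℕ := 2 * M with hLM
  have hL : 1 ≤ L := by omega
  have hLr : (1 : ℝ) ≤ L := by exact_mod_cast hL
  set η := ENNReal.ofReal (tentConst a / L) with hηdef
  set τ : ℝ := 1 / (L : ℝ) ^ 2 with hτ
  have hτ0 : 0 < τ := by positivity
  have hτ1 : τ ≤ 1 := by
    rw [hτ, div_le_one (by positivity)]
    nlinarith
  refine ⟨τ, hτ0, fun c hc => ?_⟩
  set S := sqSum c with hS
  set Y := sqSum (fun i => synth a c ((1 + τ) * γ i)) with hY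
  have hpos : 0 < 1 + τ := by linarith
  have hyj : ∀ (i : ι) (j : ℤ), γ i + τ * j / (1 + τ) - j = ((1 + τ) * γ i - j) / (1 + τ) :=
    fun i j => by field_simp; ring
  have hloc : ∀ j : ℤ, sqSum (fun n : ℤ => (tent L (n - j) : ℂ) * c n) ≤
      A * (2 * sqSum (fun i => (tent L (((1 + τ) * γ i - j) / (1 + τ)) : ℂ) *
        synth a c ((1 + τ) * γ i)) +
        2 * (η ^ 2 * k * ∑' n : ℤ, tailWeight L (n - j) * ‖c n‖ₑ ^ 2)) := by
    intro j
    refine (h (τ * j / (1 + τ)) _ (hc.subset fun n hn hn0 => hn (by simp [hn0]))).trans ?_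
    refine mul_le_mul_right ((sqSum_le_two_mul_add _ _).trans (add_le_add le_rfl ?_)) A
    refine mul_le_mul_right ?_ 2
    have := sqSum_tent_sub_le ha hδ (hγ.add_const (τ * j / (1 + τ)))
      (μ := fun i => (1 + τ) * γ i) hLr (j := j) (fun i => by
        rw [hyj, div_eq_mul_one_div _ ((L : ℝ) ^ 2), ← hτ]
        field_simp
        ring) hc
    simpa only [hyj] using this
  have hleft : L * 4⁻¹ * S ≤ ∑' j : ℤ, sqSum (fun n : ℤ => (tent L (n - j) : ℂ) * c n) := by
    simp only [sqSum, enorm_mul, mul_pow, enorm_tent]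
    rw [ENNReal.tsum_comm, hS, sqSum, ← ENNReal.tsum_mul_left]
    refine ENNReal.tsum_le_tsum fun n => ?_
    rw [ENNReal.tsum_mul_right]
    exact mul_le_mul_left (le_tsum_tent_sq hM n) _
  have hmid : ∑' j : ℤ, sqSum (fun i => (tent L (((1 + τ) * γ i - j) / (1 + τ)) : ℂ) *
      synth a c ((1 + τ) * γ i)) ≤ L * 5 * Y := by
    simp only [sqSum, enorm_mul, mul_pow, enorm_tent]
    rw [ENNReal.tsum_comm, hY, sqSum, ← ENNReal.tsum_mul_left]
    refine ENNReal.tsum_le_tsum fun i => ?_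
    rw [ENNReal.tsum_mul_right]
    exact mul_le_mul_left (tsum_tent_sq_le hL hτ0.le hτ1 _) _
  have hright : ∑' j : ℤ, ∑' n : ℤ, tailWeight L (n - j) * ‖c n‖ₑ ^ 2 ≤ L * K * S := by
    rw [ENNReal.tsum_comm, hS, sqSum, ← ENNReal.tsum_mul_left]
    refine ENNReal.tsum_le_tsum fun n => ?_
    rw [ENNReal.tsum_mul_right]
    exact mul_le_mul_left (tsum_tailWeight_le hL n) _
  have hsum : L * (4⁻¹ * S) ≤ L * (A * (2 * (5 * Y) + 2 * (η ^ 2 * k * (K * S)))) := by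
    calc _ = L * 4⁻¹ * S := by ring
      _ ≤ _ := hleft
      _ ≤ _ := ENNReal.tsum_le_tsum hloc
      _ ≤ A * (2 * (L * 5 * Y) + 2 * (η ^ 2 * k * (L * K * S))) := by
          simp only [ENNReal.tsum_mul_left, ENNReal.tsum_add]
          gcongr
      _ = _ := by ring
  rw [ENNReal.mul_le_mul_iff_right (by simpa using (by omega : L ≠ 0)) (by simp)] at hsum
  rw [mul_assoc]
  refine le_two_mul_of_le_half_add (sqSum_ne_top_of_finite hc) ?_
  calc S = 4 * (4⁻¹ * S) := by
        rw [← mul_assoc, ENNReal.mul_inv_cancel (by simp) (by simp), one_mul]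
    _ ≤ 4 * (A * (2 * (5 * Y) + 2 * (η ^ 2 * k * (K * S)))) := by gcongr
    _ = η ^ 2 * (8 * A * k * K) * S + 40 * A * Y := by ring
    _ ≤ _ := by gcongr


lemma one_lt_lowerDensity_of_uniformLower {a : ℂ} (ha : 0 < a.re) {Λ : Set ℝ}
    (hΛ : Separated Λ) {A : ℝ≥0∞} (hA : A ≠ ∞) (h : UniformLower a A (Subtype.val : Λ → ℝ)) :
    1 < lowerDensity Λ := by
  obtain ⟨δ, hδ, hsep⟩ := id hΛ
  have hγ : SepFamily δ (Subtype.val : Λ → ℝ) :=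
    fun l m hlm => hsep l l.2 m m.2 (Subtype.coe_ne_coe.mpr hlm)
  obtain ⟨τ, hτ, hdil⟩ := exists_lower_bound_dilate ha hδ hγ hA h
  have hpos : 0 < 1 + τ := by linarith
  have hμ : SepFamily δ fun l : Λ => (1 + τ) * (l : ℝ) := fun l m hlm => by
    rw [← mul_sub, abs_mul, abs_of_pos hpos]
    nlinarith [hγ l m hlm]
  obtain ⟨K, hK⟩ := exists_le_ncard_of_lower_bound ha hδ hμ
    (by simp [ENNReal.mul_eq_top, hA]) hdil
  refine one_lt_lowerDensity hΛ hτ (C := K) fun x r _ => ?_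
  have hset : Subtype.val '' {l : Λ | (1 + τ) * (l : ℝ) ∈
      Set.Icc ((1 + τ) * x) ((1 + τ) * (x + r))} = Λ ∩ Set.Icc x (x + r) := by
    ext t
    simp [mul_le_mul_iff_right₀ hpos, and_comm, and_assoc]
  have hfin := (separated_inter_Icc hδ hsep x (x + r)).1
  rw [← hset, Set.finite_image_iff Subtype.val_injective.injOn] at hfin
  have := hK _ _ hfin
  rw [← hset, Set.ncard_image_of_injective _ Subtype.val_injective]
  linarith

lemma exists_lower_bound_of_lowerDensity {a : ℂ} (ha : 0 < a.re) {Λ : Set ℝ} {δ : ℝ} (hδ : 0 < δ)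
    (hΛ : SepFamily δ (Subtype.val : Λ → ℝ)) (h : 1 < lowerDensity Λ) :
    ∃ A : ℝ≥0∞, A ≠ ∞ ∧ ∀ (x : ℝ) (c : ℤ → ℂ), sqSum c ≠ ∞ →
      sqSum c ≤ A * sqSum (fun l : Λ => synth a c (l + x)) := by
  obtain ⟨r, q, hr, hq, hdense⟩ := exists_blockDense_of_lowerDensity h
  obtain ⟨A, hA, hlow⟩ := exists_sqSum_le_of_blockDense ha hδ hr hq
  exact ⟨A, hA, fun x => hlow Λ _ (hΛ.add_const x) (hdense.add_const x)⟩

/-- frame/sampling/density equivalence for complex Gaussian windows. -/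
theorem statement5 (α σ : ℝ) (hα : 0 < α) (g : ℝ → ℂ)
    (hg : ∀ x : ℝ, g x = Complex.exp (-((α : ℂ) + (σ : ℂ) * Complex.I) * (x : ℂ) ^ 2))
    (Λ : Set ℝ) (hΛ : Separated Λ) :
    (IsGaborFrame g {p : ℝ × ℝ | p.1 ∈ Λ ∧ ∃ k : ℤ, p.2 = (k : ℝ)} ↔
      ∀ x : ℝ, IsSamplingSet g ((fun t => t + x) '' Λ)) ∧
    (IsGaborFrame g {p : ℝ × ℝ | p.1 ∈ Λ ∧ ∃ k : ℤ, p.2 = (k : ℝ)} ↔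
      1 < lowerDensity Λ) := by
  set a : ℂ := (α : ℂ) + (σ : ℂ) * Complex.I with ha_def
  have ha : 0 < a.re := by simpa [ha_def] using hα
  obtain rfl : g = chirp a := funext hg
  obtain ⟨δ, hδ, hsep⟩ := id hΛ
  have hγ : SepFamily δ (Subtype.val : Λ → ℝ) :=
    fun l m hlm => hsep l l.2 m m.2 (Subtype.coe_ne_coe.mpr hlm)
  have hframe : IsGaborFrame (chirp a) (prodInt Λ) → 1 < lowerDensity Λ := fun h => by
    obtain ⟨A, hA, hlow⟩ := exists_uniformLower_of_isGaborFrame ha hδ hγ h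
    exact one_lt_lowerDensity_of_uniformLower ha hΛ hA hlow
  have hsampling : (∀ x : ℝ, IsSamplingSet (chirp a) ((fun t => t + x) '' Λ)) →
      1 < lowerDensity Λ := fun h => by
    obtain ⟨A, hA, hlow⟩ := exists_uniformLower_of_isSamplingSet ha hδ hγ h
    exact one_lt_lowerDensity_of_uniformLower ha hΛ hA hlow
  have hdense : 1 < lowerDensity Λ → IsGaborFrame (chirp a) (prodInt Λ) ∧
      ∀ x : ℝ, IsSamplingSet (chirp a) ((fun t => t + x) '' Λ) := fun h => by
    obtain ⟨A, hA, hlow⟩ := exists_lower_bound_of_lowerDensity ha hδ hγ h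
    exact ⟨isGaborFrame_of_lower_bound ha hδ hγ hA hlow,
      fun x => isSamplingSet_of_lower_bound ha hδ hγ hA x (hlow x)⟩
  exact ⟨⟨fun h => (hdense (hframe h)).2, fun h => (hdense (hsampling h)).1⟩,
    hframe, fun h => (hdense h).1⟩

end
end

section
/- Let β > 0 and γ ∈ ℝ, and set φ(z) = β (log|z|)² + γ log|z|. Then there exist constants c₁, c₂ > 0 such that for every w ∈ ℂ∖{0}, c₁ e^{φ(w)}/|w| ≤ sup{|F(w)| : F ∈ F_{β,γ}, ‖F‖_{β,γ} ≤ 1} ≤ c₂ e^{φ(w)}/|w|. Equivalently, the norm of the reproducing kernel K_w^{β,γ} of F_{β,γ} at w satisfies ‖K_w^{β,γ}‖_{β,γ} ≍ e^{φ(w)}/|w| uniformly in w ∈ ℂ∖{0}. -/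
open MeasureTheory Filter Metric Complex

noncomputable section

/-- Area mean value property: the integral over a disc is its area times the central value. -/
theorem DiffContOnCl.setIntegral_ball {f : ℂ → ℂ} {c : ℂ} {R : ℝ} (hR : 0 ≤ R)
    (hf : DiffContOnCl ℂ f (ball c R)) :
    ∫ z in ball c R, f z = (Real.pi * R ^ 2 : ℝ) • f c := by
  have hcont : ContinuousOn f (closedBall c R) :=
    hf.continuousOn_ball
  have hint : IntegrableOn (fun p : ℝ × ℝ => p.1 • f (circleMap c p.1 p.2))
      (Set.Ioo 0 R ×ˢ Set.Ioo (-Real.pi) Real.pi) (volume.prod volume) := by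
    refine IntegrableOn.mono_set (t := Set.Icc 0 R ×ˢ Set.Icc (-Real.pi) Real.pi) ?_
      (Set.prod_mono Set.Ioo_subset_Icc_self Set.Ioo_subset_Icc_self)
    refine ContinuousOn.integrableOn_compact (isCompact_Icc.prod isCompact_Icc) ?_
    refine continuousOn_fst.smul (hcont.comp ?_ ?_)
    · unfold circleMap
      fun_prop
    · rintro ⟨r, θ⟩ ⟨hr, -⟩
      simpa [dist_eq_norm, circleMap, abs_of_nonneg hr.1] using hr.2
  have hinner : ∀ r ∈ Set.Ioo 0 R,
      ∫ θ in Set.Ioo (-Real.pi) Real.pi, r • f (circleMap c r θ) = r • (2 * Real.pi) • f c := by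
    intro r hr
    have havg : Real.circleAverage f c r = f c := by
      refine DiffContOnCl.circleAverage (hf.mono (ball_subset_ball ?_))
      rw [abs_of_pos hr.1]
      exact hr.2.le
    have hper : Function.Periodic (fun θ => f (circleMap c r θ)) (2 * Real.pi) :=
      (periodic_circleMap c r).comp f
    have hshift := hper.intervalIntegral_add_eq (-Real.pi) 0
    rw [show -Real.pi + 2 * Real.pi = Real.pi by ring, zero_add] at hshift
    rw [integral_smul, ← integral_Ioc_eq_integral_Ioo,
      ← intervalIntegral.integral_of_le (by linarith [Real.pi_pos]), hshift, ← havg,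
      Real.circleAverage_def, smul_smul (2 * Real.pi), mul_inv_cancel₀ (by positivity), one_smul]
  calc ∫ z in ball c R, f z
      = ∫ z, (ball c R).indicator f (c + z) := by
        rw [integral_add_left_eq_self, integral_indicator measurableSet_ball]
    _ = ∫ p in Set.Ioi (0 : ℝ) ×ˢ Set.Ioo (-Real.pi) Real.pi,
          (Set.Ioo 0 R ×ˢ Set.Ioo (-Real.pi) Real.pi).indicator
            (fun p : ℝ × ℝ => p.1 • f (circleMap c p.1 p.2)) p := by
        rw [← Complex.integral_comp_polarCoord_symm, polarCoord_target]
        refine setIntegral_congr_fun (measurableSet_Ioi.prod measurableSet_Ioo) ?_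
        rintro ⟨r, θ⟩ ⟨hr, hθ⟩
        have hr' : 0 < r := hr
        have hmap : c + Complex.polarCoord.symm (r, θ) = circleMap c r θ := by
          simp [circleMap, Complex.exp_mul_I]
        have hmem : circleMap c r θ ∈ ball c R ↔ r < R := by
          simp [dist_eq_norm, circleMap, abs_of_pos hr']
        by_cases h : r < R
        · have h1 : ((r, θ) : ℝ × ℝ) ∈ Set.Ioo 0 R ×ˢ Set.Ioo (-Real.pi) Real.pi := ⟨⟨hr', h⟩, hθ⟩
          simp only [hmap, Set.indicator_of_mem (hmem.2 h), Set.indicator_of_mem h1]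
        · have h1 : ((r, θ) : ℝ × ℝ) ∉ Set.Ioo 0 R ×ˢ Set.Ioo (-Real.pi) Real.pi :=
            fun h2 => h h2.1.2
          simp only [hmap, Set.indicator_of_notMem (mt hmem.1 h), Set.indicator_of_notMem h1,
            smul_zero]
    _ = ∫ p in Set.Ioo 0 R ×ˢ Set.Ioo (-Real.pi) Real.pi, p.1 • f (circleMap c p.1 p.2) := by
        rw [setIntegral_indicator (measurableSet_Ioo.prod measurableSet_Ioo),
          Set.inter_eq_self_of_subset_right (Set.prod_mono Set.Ioo_subset_Ioi_self subset_rfl)]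
    _ = ∫ r in Set.Ioo 0 R, r • (2 * Real.pi) • f c := by
        rw [Measure.volume_eq_prod, setIntegral_prod _ hint]
        exact setIntegral_congr_fun measurableSet_Ioo hinner
    _ = (Real.pi * R ^ 2 : ℝ) • f c := by
        rw [integral_smul_const, ← integral_Ioc_eq_integral_Ioo,
          ← intervalIntegral.integral_of_le hR, integral_id, smul_smul]
        congr 1
        ring

theorem norm_zpow_sq_mul_exp_neg_phiF (β γ : ℝ) (n : ℤ) {z : ℂ} (hz : z ≠ 0) :
    ‖z ^ n‖ ^ 2 * Real.exp (-2 * phiF β γ z) =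
      Real.exp (2 * ((n - γ) * Real.log ‖z‖ - β * Real.log ‖z‖ ^ 2)) := by
  have hpos : 0 < ‖z‖ := norm_pos_iff.2 hz
  have hzn : ‖z ^ n‖ = Real.exp (n * Real.log ‖z‖) := by
    rw [norm_zpow, ← Real.rpow_intCast, Real.rpow_def_of_pos hpos, mul_comm]
  rw [hzn, ← Real.exp_nat_mul, ← Real.exp_add, phiF]
  congr 1
  push_cast
  ring

/-- The integral of a radial function on `ℂ` in the logarithmic radial variable. -/
theorem integrable_comp_log_norm {g : ℝ → ℝ}
    (hg : Integrable fun t => Real.exp (2 * t) * g t) :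
    Integrable (fun z : ℂ => g (Real.log ‖z‖)) ∧
      ∫ z : ℂ, g (Real.log ‖z‖) = 2 * Real.pi * ∫ t, Real.exp (2 * t) * g t := by
  have hderiv : ∀ t ∈ Set.univ, HasDerivWithinAt Real.exp (Real.exp t) Set.univ t :=
    fun t _ => (Real.hasDerivAt_exp t).hasDerivWithinAt
  have hpt : ∀ t : ℝ, |Real.exp t| • (Real.exp t ^ (Module.finrank ℝ ℂ - 1) •
      g (Real.log (Real.exp t))) = Real.exp (2 * t) * g t := by
    intro t
    rw [Complex.finrank_real_complex, Real.log_exp, abs_of_pos (Real.exp_pos t), two_mul,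
      Real.exp_add]
    simp [mul_assoc]
  constructor
  · rw [integrable_fun_norm_addHaar volume (f := fun r => g (Real.log r)), ← Real.range_exp,
      ← Set.image_univ, integrableOn_image_iff_integrableOn_abs_deriv_smul MeasurableSet.univ hderiv
        Real.exp_injective.injOn, integrableOn_univ]
    simpa only [hpt] using hg
  · rw [integral_fun_norm_addHaar volume (fun r => g (Real.log r)), ← Real.range_exp,
      ← Set.image_univ, integral_image_eq_integral_abs_deriv_smul MeasurableSet.univ hderiv
        Real.exp_injective.injOn, setIntegral_univ]
    simp only [hpt]
    simp [Measure.real, Complex.volume_ball, Complex.finrank_real_complex, mul_assoc]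

/-- Monomials belong to the Fock space, with an explicit Gaussian norm. -/
theorem memFock_zpow {β : ℝ} (hβ : 0 < β) (γ : ℝ) (n : ℤ) :
    MemFock β γ (fun z => z ^ n) ∧
      fockNormSq β γ (fun z => z ^ n) =
        Real.exp ((n + 1 - γ) ^ 2 / (2 * β)) * (2 * √(Real.pi / (2 * β))) := by
  set m : ℝ := (n + 1 - γ) / (2 * β) with hm
  have hexp : ∀ t : ℝ, Real.exp (2 * t) * Real.exp (2 * ((n - γ) * t - β * t ^ 2)) =
      Real.exp ((n + 1 - γ) ^ 2 / (2 * β)) * Real.exp (-(2 * β) * (t - m) ^ 2) := by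
    intro t
    rw [← Real.exp_add, ← Real.exp_add, hm]
    congr 1
    field_simp
    ring
  have hg : Integrable fun t : ℝ =>
      Real.exp (2 * t) * Real.exp (2 * ((n - γ) * t - β * t ^ 2)) := by
    simp only [hexp]
    exact ((integrable_exp_neg_mul_sq (by positivity : 0 < 2 * β)).comp_sub_right m).const_mul _
  obtain ⟨hint, hval⟩ := integrable_comp_log_norm hg
  have hae : (fun z : ℂ => ‖z ^ n‖ ^ 2 * Real.exp (-2 * phiF β γ z)) =ᵐ[volume]
      fun z => Real.exp (2 * ((n - γ) * Real.log ‖z‖ - β * Real.log ‖z‖ ^ 2)) := by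
    filter_upwards [Measure.ae_ne volume (0 : ℂ)] with z hz
    exact norm_zpow_sq_mul_exp_neg_phiF β γ n hz
  refine ⟨⟨fun z hz => (differentiableAt_zpow.2 (.inl hz)).differentiableWithinAt,
    (integrable_congr hae).2 hint⟩, ?_⟩
  rw [fockNormSq, integral_congr_ae hae, hval]
  simp only [hexp]
  rw [integral_const_mul, integral_sub_right_eq_self (fun t => Real.exp (-(2 * β) * t ^ 2)),
    integral_gaussian]
  field_simp

theorem MemFock.const_mul {β γ : ℝ} {F : ℂ → ℂ} (hF : MemFock β γ F) (a : ℂ) :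
    MemFock β γ (fun z => a * F z) := by
  refine ⟨hF.1.const_mul a, (hF.2.const_mul (‖a‖ ^ 2)).congr (.of_forall fun z => ?_)⟩
  simp only [norm_mul]
  ring

theorem fockNormSq_const_mul (β γ : ℝ) (F : ℂ → ℂ) (a : ℂ) :
    fockNormSq β γ (fun z => a * F z) = ‖a‖ ^ 2 * fockNormSq β γ F := by
  simp only [fockNormSq, norm_mul, mul_pow, mul_assoc]
  rw [integral_const_mul]
  ring

/-- The monomial whose weighted modulus peaks near the circle through `w`. -/
theorem exists_int_peak (β γ s : ℝ) : ∃ n : ℤ, |(n + 1 - γ) - 2 * β * s| ≤ 1 / 2 := by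
  refine ⟨round (2 * β * s + γ - 1), ?_⟩
  rw [abs_sub_comm]
  refine le_of_eq_of_le (congrArg _ ?_) (abs_sub_round (2 * β * s + γ - 1))
  ring

/-- Lower bound for point evaluations, attained by a normalized monomial. -/
theorem exists_memFock_le_norm {β : ℝ} (hβ : 0 < β) (γ : ℝ) {w : ℂ} (hw : w ≠ 0) :
    ∃ F : ℂ → ℂ, MemFock β γ F ∧ fockNormSq β γ F ≤ 1 ∧
      Real.exp (-(1 / (16 * β))) / √(2 * √(Real.pi / (2 * β))) *
        (Real.exp (phiF β γ w) / ‖w‖) ≤ ‖F w‖ := by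
  obtain ⟨n, hn⟩ := exists_int_peak β γ (Real.log ‖w‖)
  obtain ⟨hmem, hnorm⟩ := memFock_zpow hβ γ n
  set s := Real.log ‖w‖ with hs
  set K : ℝ := 2 * √(Real.pi / (2 * β)) with hK
  have hKpos : 0 < K := by positivity
  have hpos : 0 < ‖w‖ := norm_pos_iff.2 hw
  set a : ℝ := Real.exp (-((n + 1 - γ) ^ 2 / (4 * β))) / √K with ha
  have ha0 : 0 < a := by positivity
  refine ⟨fun z => (a : ℂ) * z ^ n, hmem.const_mul _, ?_, ?_⟩
  · rw [fockNormSq_const_mul, hnorm, Complex.norm_real, Real.norm_of_nonneg ha0.le, ha, div_pow,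
      Real.sq_sqrt hKpos.le, ← Real.exp_nat_mul, div_mul_eq_mul_div, ← mul_assoc, ← Real.exp_add,
      mul_div_assoc, div_self hKpos.ne', mul_one, Real.exp_le_one_iff]
    apply le_of_eq
    push_cast
    field_simp
    ring
  · have hwn : ‖w ^ n‖ = Real.exp (n * s) := by
      rw [norm_zpow, ← Real.rpow_intCast, Real.rpow_def_of_pos hpos, mul_comm]
    have hwe : ‖w‖ = Real.exp s := (Real.exp_log hpos).symm
    rw [norm_mul, Complex.norm_real, Real.norm_of_nonneg ha0.le, ha, hwn, hwe, ← Real.exp_sub,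
      div_mul_eq_mul_div, div_mul_eq_mul_div, ← Real.exp_add, ← Real.exp_add]
    refine div_le_div_of_nonneg_right (Real.exp_le_exp.2 ?_) (Real.sqrt_nonneg _)
    have hsq : ((n + 1 - γ) - 2 * β * s) ^ 2 ≤ 1 / 4 := by
      have := sq_le_sq' (abs_le.1 hn).1 (abs_le.1 hn).2
      linarith
    have hphi : phiF β γ w = β * s ^ 2 + γ * s := rfl
    have key : n * s - (β * s ^ 2 + γ * s - s) - (n + 1 - γ) ^ 2 / (4 * β) =
        -(((n + 1 - γ) - 2 * β * s) ^ 2 / (4 * β)) := by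
      field_simp
      ring
    have hdiv : ((n + 1 - γ) - 2 * β * s) ^ 2 / (4 * β) ≤ 1 / (16 * β) := by
      rw [div_le_div_iff₀ (by positivity) (by positivity)]
      nlinarith
    rw [hphi]
    linarith

theorem abs_log_sub_log_le_one {x y : ℝ} (hx : 0 < x) (h₁ : x / 2 ≤ y) (h₂ : y ≤ 2 * x) :
    |Real.log y - Real.log x| ≤ 1 := by
  have hy : 0 < y := by linarith
  rw [← Real.log_div hy.ne' hx.ne', abs_le]
  have hl := Real.log_two_lt_d9
  constructor
  · have : Real.log (2⁻¹) ≤ Real.log (y / x) :=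
      Real.log_le_log (by norm_num) (by rw [le_div_iff₀ hx]; linarith)
    rw [Real.log_inv] at this
    linarith
  · have : Real.log (y / x) ≤ Real.log 2 :=
      Real.log_le_log (by positivity) (by rwa [div_le_iff₀ hx])
    linarith

/-- Upper bound for point evaluations, from the area mean value property. -/
theorem MemFock.norm_le {β : ℝ} (hβ : 0 < β) {γ : ℝ} {F : ℂ → ℂ} (hF : MemFock β γ F)
    (hF1 : fockNormSq β γ F ≤ 1) {w : ℂ} (hw : w ≠ 0) :
    ‖F w‖ ≤ 2 * Real.exp (3 / 2 + β) * (Real.exp (phiF β γ w) / ‖w‖) := by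
  obtain ⟨n, hn⟩ := exists_int_peak β γ (Real.log ‖w‖)
  have hpos : 0 < ‖w‖ := norm_pos_iff.2 hw
  set s := Real.log ‖w‖ with hs
  set R := ‖w‖ / 2 with hR
  set W : ℂ → ℝ := fun z => ‖z ^ n‖ ^ 2 * Real.exp (-2 * phiF β γ z) with hW
  have hWpos : 0 < W w := by
    have := zpow_ne_zero n hw
    positivity
  have hnear : ∀ z ∈ closedBall w R, ‖w‖ / 2 ≤ ‖z‖ ∧ ‖z‖ ≤ 2 * ‖w‖ := by
    intro z hz
    rw [mem_closedBall, dist_eq_norm] at hz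
    have h1 := norm_sub_norm_le w z
    have h2 := norm_sub_norm_le z w
    rw [norm_sub_rev] at h1
    constructor <;> linarith
  have hne : ∀ z ∈ closedBall w R, z ≠ 0 := fun z hz =>
    norm_pos_iff.1 (by linarith [(hnear z hz).1])
  have hdiff : DifferentiableOn ℂ (fun z => (F z / z ^ n) ^ 2) (closedBall w R) := by
    have hzn : DifferentiableOn ℂ (fun z : ℂ => z ^ n) (closedBall w R) := fun z hz =>
      (differentiableAt_zpow.2 (.inl (hne z hz))).differentiableWithinAt
    exact ((hF.1.mono hne).div hzn fun z hz => zpow_ne_zero n (hne z hz)).pow 2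
  have hmean := DiffContOnCl.setIntegral_ball (R := R) (by positivity)
    (hdiff.diffContOnCl_ball subset_rfl)
  have hweight : ∀ z ∈ closedBall w R, W w ≤ Real.exp (3 + 2 * β) * W z := by
    intro z hz
    simp only [hW]
    rw [norm_zpow_sq_mul_exp_neg_phiF β γ n hw, norm_zpow_sq_mul_exp_neg_phiF β γ n (hne z hz),
      ← Real.exp_add]
    refine Real.exp_le_exp.2 ?_
    obtain ⟨σ, hσ⟩ : ∃ σ, Real.log ‖z‖ = s + σ := ⟨Real.log ‖z‖ - s, by ring⟩
    have hσ1 : |σ| ≤ 1 := by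
      have := abs_log_sub_log_le_one hpos (hnear z hz).1 (hnear z hz).2
      rwa [hσ, add_sub_cancel_left] at this
    have hlin : |(2 * γ - 2 * n + 4 * β * s) * σ| ≤ 3 := by
      rw [abs_mul]
      have : |2 * γ - 2 * n + 4 * β * s| ≤ 3 := by
        rw [abs_le] at hn ⊢
        constructor <;> linarith
      nlinarith [abs_nonneg σ, abs_nonneg (2 * γ - 2 * n + 4 * β * s)]
    have hsq : σ ^ 2 ≤ 1 := (sq_le_one_iff_abs_le_one σ).2 hσ1
    rw [hσ]
    nlinarith [(abs_le.1 hlin).2]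
  have hpoint : ∀ z ∈ ball w R, ‖(F z / z ^ n) ^ 2‖ ≤
      Real.exp (3 + 2 * β) / W w * (‖F z‖ ^ 2 * Real.exp (-2 * phiF β γ z)) := by
    intro z hz
    have hz' := ball_subset_closedBall hz
    have hzpos : 0 < ‖z ^ n‖ := norm_pos_iff.2 (zpow_ne_zero n (hne z hz'))
    have hwt := hweight z hz'
    rw [norm_pow, norm_div, div_pow, div_mul_eq_mul_div, div_le_div_iff₀ (by positivity) hWpos]
    calc ‖F z‖ ^ 2 * W w ≤ ‖F z‖ ^ 2 * (Real.exp (3 + 2 * β) * W z) := by gcongr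
      _ = _ := by simp only [hW]; ring
  have hint : IntegrableOn (fun z => Real.exp (3 + 2 * β) / W w *
      (‖F z‖ ^ 2 * Real.exp (-2 * phiF β γ z))) (ball w R) :=
    (hF.2.const_mul _).integrableOn
  have htotal : ∫ z, ‖F z‖ ^ 2 * Real.exp (-2 * phiF β γ z) ≤ Real.pi := by
    rw [fockNormSq, one_div, inv_mul_le_iff₀ Real.pi_pos, mul_one] at hF1
    exact hF1
  have hmain : Real.pi * R ^ 2 * (‖F w‖ ^ 2 / ‖w ^ n‖ ^ 2) ≤
      Real.exp (3 + 2 * β) / W w * Real.pi := by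
    calc Real.pi * R ^ 2 * (‖F w‖ ^ 2 / ‖w ^ n‖ ^ 2)
        = ‖∫ z in ball w R, (F z / z ^ n) ^ 2‖ := by
          rw [hmean, norm_smul, Real.norm_of_nonneg (by positivity), norm_pow, norm_div,
            div_pow ‖F w‖]
      _ ≤ ∫ z in ball w R, Real.exp (3 + 2 * β) / W w *
            (‖F z‖ ^ 2 * Real.exp (-2 * phiF β γ z)) :=
          norm_integral_le_of_norm_le hint
            ((ae_restrict_iff' measurableSet_ball).2 (.of_forall hpoint))
      _ ≤ ∫ z, Real.exp (3 + 2 * β) / W w * (‖F z‖ ^ 2 * Real.exp (-2 * phiF β γ z)) :=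
          setIntegral_le_integral (hF.2.const_mul _) (.of_forall fun z => by positivity)
      _ ≤ Real.exp (3 + 2 * β) / W w * Real.pi := by
          rw [integral_const_mul]
          gcongr
  refine le_of_sq_le_sq ?_ (by positivity)
  have hwn : 0 < ‖w ^ n‖ := norm_pos_iff.2 (zpow_ne_zero n hw)
  have hexp : Real.exp (3 + 2 * β) = Real.exp (3 / 2 + β) ^ 2 := by
    rw [← Real.exp_nat_mul]
    congr 1
    push_cast
    ring
  have hphi : Real.exp (-2 * phiF β γ w) = (Real.exp (phiF β γ w) ^ 2)⁻¹ := by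
    rw [← Real.exp_nat_mul, ← Real.exp_neg]
    congr 1
    push_cast
    ring
  simp only [hW, hexp, hphi, hR] at hmain
  have hpi := Real.pi_pos
  have hmain' : Real.pi * (‖w‖ / 2) ^ 2 * ‖F w‖ ^ 2 ≤
      Real.exp (3 / 2 + β) ^ 2 * Real.exp (phiF β γ w) ^ 2 * Real.pi := by
    have h := mul_le_mul_of_nonneg_right hmain (sq_nonneg ‖w ^ n‖)
    calc _ = Real.pi * (‖w‖ / 2) ^ 2 * (‖F w‖ ^ 2 / ‖w ^ n‖ ^ 2) * ‖w ^ n‖ ^ 2 := by field_simp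
      _ ≤ _ := h
      _ = _ := by field_simp
  have hcancel : (‖w‖ / 2) ^ 2 * ‖F w‖ ^ 2 ≤
      Real.exp (3 / 2 + β) ^ 2 * Real.exp (phiF β γ w) ^ 2 :=
    le_of_mul_le_mul_right (by linarith) hpi
  rw [mul_div_assoc', div_pow, le_div_iff₀ (by positivity)]
  nlinarith

/-- two-sided estimate for the norm of the evaluation functional (equivalently,
of the reproducing kernel) of `F_{β,γ}`: `‖K_w‖ ≍ e^{φ(w)}/|w|`. -/
theorem statement7 (β γ : ℝ) (hβ : 0 < β) :
    ∃ c₁ c₂ : ℝ, 0 < c₁ ∧ 0 < c₂ ∧ ∀ w : ℂ, w ≠ 0 →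
      (∃ F : ℂ → ℂ, MemFock β γ F ∧ fockNormSq β γ F ≤ 1 ∧
        c₁ * (Real.exp (phiF β γ w) / ‖w‖) ≤ ‖F w‖) ∧
      (∀ F : ℂ → ℂ, MemFock β γ F → fockNormSq β γ F ≤ 1 →
        ‖F w‖ ≤ c₂ * (Real.exp (phiF β γ w) / ‖w‖)) := by
  refine ⟨Real.exp (-(1 / (16 * β))) / √(2 * √(Real.pi / (2 * β))), 2 * Real.exp (3 / 2 + β),
    by positivity, by positivity, fun w hw => ⟨exists_memFock_le_norm hβ γ hw,
      fun F hF hF1 => hF.norm_le hβ hF1 hw⟩⟩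

end
end
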